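/- arXiv:1612.05392 — 2 statements merged into one kernel-verified Lean document; each statement's English description precedes it below -/
import Mathlib

section
/- Let X be a separable Hilbert space with X = Y ⊕ Z as in the setup, and let φ ∈ C¹(X, ℝ) be an even functional with ∇φ weakly sequentially continuous. Suppose there exist k ∈ ℕ and ρ_k > r_k > 0 such that d_k := sup{φ(u) : u ∈ Y_k, ‖u‖ ≤ ρ_k} < ∞, a_k := sup{φ(u) : u ∈ Y_k, ‖u‖ = ρ_k} < inf{φ(u) : u ∈ Z_k, ‖u‖ ≤ r_k}, and there exists δ > 0 such that b_k := inf{φ(u) : u ∈ Z_k, ‖u‖ = r_k} > sup{φ(u) : ‖u‖_τ < δ}. Then there exists a sequence {u_n} ⊂ {u ∈ X : φ(u) ≤ d_k + 1} such that inf_n ‖u_n‖_τ ≥ δ/2 and φ'(u_n) → 0 in X'. -/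
open Filter Topology Metric Set
open scoped RealInnerProductSpace

noncomputable section

/-- The setup of the fountain theorem: a separable Hilbert space `X = Y ⊕ Z`,
where `Y` is a closed subspace with orthonormal (topological) basis `e`,
`Z = Yᗮ` has orthonormal (topological) basis `f`, and `P`, `Q` are the
orthogonal projections onto `Y` and `Z` respectively. -/
structure FountainSetup (X : Type*) [NormedAddCommGroup X] [InnerProductSpace ℝ X]
    [CompleteSpace X] : Type _ where
  separable : TopologicalSpace.SeparableSpace X
  Y : Submodule ℝ X
  closedY : IsClosed (Y : Set X)
  e : ℕ → X
  f : ℕ → X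
  orth_e : Orthonormal ℝ e
  orth_f : Orthonormal ℝ f
  e_mem : ∀ j, e j ∈ Y
  f_mem : ∀ j, f j ∈ Yᗮ
  span_e : (Submodule.span ℝ (Set.range e)).topologicalClosure = Y
  span_f : (Submodule.span ℝ (Set.range f)).topologicalClosure = Yᗮ
  P : X →L[ℝ] X
  Q : X →L[ℝ] X
  P_mem : ∀ u, P u ∈ Y
  Q_mem : ∀ u, Q u ∈ Yᗮ
  P_add_Q : ∀ u, P u + Q u = u

namespace FountainSetup

variable {X : Type*} [NormedAddCommGroup X] [InnerProductSpace ℝ X] [CompleteSpace X]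
variable (S : FountainSetup X)

/-- `Y_k = Y ⊕ (⊕_{j=0}^{k} ℝ f_j)`. -/
def Yk (k : ℕ) : Submodule ℝ X := S.Y ⊔ Submodule.span ℝ (S.f '' {j | j ≤ k})

/-- `Z_k` = closure of `⊕_{j=k}^{∞} ℝ f_j`. -/
def Zk (k : ℕ) : Submodule ℝ X :=
  (Submodule.span ℝ (S.f '' {j | k ≤ j})).topologicalClosure

/-- The τ-norm `‖u‖_τ = max { Σ_j 2^{-(j+1)} |⟨Pu, e_j⟩| , ‖Qu‖ }`. -/
def tauNorm (u : X) : ℝ :=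
  max (∑' j : ℕ, (1 / 2 : ℝ) ^ (j + 1) * |⟪S.P u, S.e j⟫|) ‖S.Q u‖

/-- Convergence of a sequence in the τ-topology (which is induced by the norm `tauNorm`,
hence metrizable, so sequential convergence describes it completely). -/
def TauTendsto (u : ℕ → X) (v : X) : Prop :=
  Tendsto (fun n => S.tauNorm (u n - v)) atTop (𝓝 0)

end FountainSetup

/-- Weak convergence of a sequence in a Hilbert space. -/
def WeakConv {X : Type*} [NormedAddCommGroup X] [InnerProductSpace ℝ X]
    (u : ℕ → X) (v : X) : Prop :=
  ∀ w : X, Tendsto (fun n => ⟪u n, w⟫) atTop (𝓝 ⟪v, w⟫)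

/-- `∇φ` is weakly sequentially continuous: `φ'(u_n) v → φ'(u) v` for all `v`
whenever `u_n ⇀ u` weakly. -/
def WeaklySeqContDeriv {X : Type*} [NormedAddCommGroup X] [InnerProductSpace ℝ X]
    (φ' : X → X →L[ℝ] ℝ) : Prop :=
  ∀ (u : ℕ → X) (v : X), WeakConv u v →
    ∀ w : X, Tendsto (fun n => φ' (u n) w) atTop (𝓝 (φ' v w))

/-! ### Cubical cochains with values in `ZMod 2`

A point `c : Fin m → ℤ` encodes the cube of the grid `(2ℤ)^m` with centre `c`; its directions are
the coordinates `i` for which `c i` is odd. -/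

section Cubical

variable {m : ℕ}

/-- The cubical coboundary modulo two. -/
def cubicalCobdry (g : (Fin m → ℤ) → ZMod 2) (c : Fin m → ℤ) : ZMod 2 :=
  ∑ i, if Odd (c i) then
    g (Function.update c i (c i + 1)) + g (Function.update c i (c i - 1)) else 0

lemma cubicalCobdry_add (g h : (Fin m → ℤ) → ZMod 2) :
    cubicalCobdry (g + h) = cubicalCobdry g + cubicalCobdry h := by
  funext c
  simp only [cubicalCobdry, Pi.add_apply, ← Finset.sum_add_distrib]
  refine Finset.sum_congr rfl fun i _ => ?_
  split_ifs <;> ring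

lemma cubicalCobdry_cubicalCobdry (g : (Fin m → ℤ) → ZMod 2) (c : Fin m → ℤ) :
    cubicalCobdry (cubicalCobdry g) c = 0 := by
  let T : Fin m × Fin m → ZMod 2 := fun p =>
    if p.1 ≠ p.2 ∧ Odd (c p.1) ∧ Odd (c p.2) then
      (g (Function.update (Function.update c p.1 (c p.1 + 1)) p.2 (c p.2 + 1)) +
        g (Function.update (Function.update c p.1 (c p.1 + 1)) p.2 (c p.2 - 1))) +
      (g (Function.update (Function.update c p.1 (c p.1 - 1)) p.2 (c p.2 + 1)) +
        g (Function.update (Function.update c p.1 (c p.1 - 1)) p.2 (c p.2 - 1))) else 0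
  have hT : cubicalCobdry (cubicalCobdry g) c = ∑ p : Fin m × Fin m, T p := by
    rw [Fintype.sum_prod_type]
    unfold cubicalCobdry
    refine Finset.sum_congr rfl fun i _ => ?_
    split_ifs with hi
    · rw [← Finset.sum_add_distrib]
      refine Finset.sum_congr rfl fun k _ => ?_
      by_cases hik : i = k
      · subst hik
        have h1 : ¬ Odd (c i + 1) := by simpa using hi.add_one
        have h2 : ¬ Odd (c i - 1) := by simpa using hi.sub_odd odd_one
        simp [T, h1, h2]
      · have hki : k ≠ i := Ne.symm hik
        by_cases hk : Odd (c k) <;> simp [T, hi, hk, hik, hki]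
    · symm
      refine Finset.sum_eq_zero fun k _ => ?_
      simp [T, hi]
  rw [hT]
  refine Finset.sum_involution (fun p _ => p.swap) ?_ ?_ (by simp) (by simp)
  · rintro ⟨i, k⟩ -
    by_cases h : i ≠ k ∧ Odd (c i) ∧ Odd (c k)
    · have h' : k ≠ i ∧ Odd (c k) ∧ Odd (c i) := ⟨h.1.symm, h.2.2, h.2.1⟩
      simp only [T, Prod.swap, if_pos h, if_pos h', Function.update_comm h.1]
      generalize g _ = a
      generalize g _ = b
      generalize g _ = a'
      generalize g _ = b'
      clear h h'
      revert a b a' b'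
      decide
    · have h' : ¬ (k ≠ i ∧ Odd (c k) ∧ Odd (c i)) := fun H => h ⟨H.1.symm, H.2.2, H.2.1⟩
      simp only [T, Prod.swap, h, h']
      simp
  · rintro ⟨i, k⟩ - hne heq
    apply hne
    have : k = i := congrArg Prod.fst heq
    simp [T, this]

lemma cubicalCobdry_comp_neg (g : (Fin m → ℤ) → ZMod 2) (c : Fin m → ℤ) :
    cubicalCobdry g (-c) = cubicalCobdry (fun x => g (-x)) c := by
  unfold cubicalCobdry
  refine Finset.sum_congr rfl fun i _ => ?_
  have h1 : -Function.update c i (c i - 1) = Function.update (-c) i ((-c) i + 1) := by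
    ext k; by_cases h : k = i
    · subst h; simp; ring
    · simp [h]
  have h2 : -Function.update c i (c i + 1) = Function.update (-c) i ((-c) i - 1) := by
    ext k; by_cases h : k = i
    · subst h; simp; ring
    · simp [h]
  simp only [h1, h2]
  simp only [Pi.neg_apply, odd_neg]
  split_ifs <;> ring

lemma cubicalCobdry_zero_right (g : (Fin m → ℤ) → ZMod 2) : cubicalCobdry g 0 = 0 := by
  simp [cubicalCobdry]

/-- Iterated coboundaries `δ (s j · δ (s (j - 1) · ⋯ δ (s 0 · g)))`; for functions `s j` that are
odd under the antipodal map this represents a power of the first Stiefel-Whitney class. -/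
def cubicalTower (s : ℕ → (Fin m → ℤ) → ZMod 2) (g : (Fin m → ℤ) → ZMod 2) :
    ℕ → (Fin m → ℤ) → ZMod 2
  | 0 => g
  | j + 1 => cubicalCobdry (s j * cubicalTower s g j)

lemma cubicalTower_neg {s : ℕ → (Fin m → ℤ) → ZMod 2} {g : (Fin m → ℤ) → ZMod 2}
    (hg : ∀ c, g (-c) = g c) (hs0 : ∀ c, s 0 c = 1)
    (hs : ∀ j, j ≠ 0 → ∀ c, c ≠ 0 → s j (-c) = s j c + 1) (j : ℕ) (c : Fin m → ℤ) :
    cubicalTower s g j (-c) = cubicalTower s g j c := by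
  induction j generalizing c with
  | zero => exact hg c
  | succ j ih =>
    simp only [cubicalTower]
    rw [cubicalCobdry_comp_neg]
    rcases j with _ | j
    · congr 1
      funext x
      simp [ih, hs0]
    · have : (fun x => (s (j + 1) * cubicalTower s g (j + 1)) (-x)) =
          s (j + 1) * cubicalTower s g (j + 1) + cubicalTower s g (j + 1) := by
        funext x
        simp only [Pi.mul_apply, Pi.add_apply, ih]
        by_cases hx : x = 0
        · subst hx
          have : cubicalTower s g (j + 1) 0 = 0 := cubicalCobdry_zero_right _
          simp [this]
        · rw [hs _ (by simp) x hx]; ring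
      rw [this, cubicalCobdry_add, Pi.add_apply]
      conv_lhs => rw [cubicalTower]
      rw [cubicalCobdry_cubicalCobdry, add_zero, ← cubicalTower]

lemma cubicalTower_eq_zero {s : ℕ → (Fin m → ℤ) → ZMod 2} {g : (Fin m → ℤ) → ZMod 2} {z : ℤ}
    (hz : Even z) (hg : ∀ c i, c i = z → g c = 0) (j : ℕ) (c : Fin m → ℤ) (i : Fin m)
    (hc : c i = z) : cubicalTower s g j c = 0 := by
  induction j generalizing c with
  | zero => exact hg c i hc
  | succ j ih =>
    rw [cubicalTower, cubicalCobdry]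
    refine Finset.sum_eq_zero fun k _ => ?_
    split_ifs with hk
    · have hik : i ≠ k := by
        rintro rfl
        rw [hc] at hk
        exact (Int.not_odd_iff_even.2 hz) hk
      simp [ih, hik, hc]
    · rfl

lemma exists_face_of_cubicalCobdry_ne_zero {g : (Fin m → ℤ) → ZMod 2} {c : Fin m → ℤ}
    (h : cubicalCobdry g c ≠ 0) : ∃ v, (∀ i, |v i - c i| ≤ 1) ∧ g v ≠ 0 := by
  by_contra! H
  apply h
  refine Finset.sum_eq_zero fun k _ => ?_
  have hk : ∀ x : ℤ, |x - c k| ≤ 1 → g (Function.update c k x) = 0 := by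
    refine fun x hx => H _ fun i => ?_
    by_cases hik : i = k
    · subst hik; simpa using hx
    · simp [hik]
  rw [hk _ (by simp), hk _ (by simp), add_zero, ite_self]

lemma zmod_two_eq_one {a : ZMod 2} (h : a ≠ 0) : a = 1 := by
  revert a; decide

lemma exists_faces_of_cubicalCobdry_mul_ne_zero {s g : (Fin m → ℤ) → ZMod 2} {c : Fin m → ℤ}
    (hg : cubicalCobdry g c = 0) (h : cubicalCobdry (s * g) c ≠ 0) :
    ∃ v v', (∀ i, |v i - c i| ≤ 1) ∧ (∀ i, |v' i - c i| ≤ 1) ∧ g v' ≠ 0 ∧ s v = 0 ∧ s v' = 1 := by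
  obtain ⟨v', hv', hsg⟩ := exists_face_of_cubicalCobdry_ne_zero h
  have hs : s v' ≠ 0 := fun h0 => hsg (by simp [h0])
  have hg' : g v' ≠ 0 := fun h0 => hsg (by simp [h0])
  have h2 : cubicalCobdry (s * g + g) c ≠ 0 := by
    rwa [cubicalCobdry_add, Pi.add_apply, hg, add_zero]
  obtain ⟨v, hv, hsv⟩ := exists_face_of_cubicalCobdry_ne_zero h2
  refine ⟨v, v', hv, hv', hg', ?_, zmod_two_eq_one hs⟩
  by_contra h0
  apply hsv
  have : s v = 1 := zmod_two_eq_one h0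
  simp only [Pi.add_apply, Pi.mul_apply, this, one_mul]
  generalize g v = a
  revert a; decide

lemma exists_near_of_cubicalTower_ne_zero {s : ℕ → (Fin m → ℤ) → ZMod 2}
    {g : (Fin m → ℤ) → ZMod 2} (hs0 : ∀ c, s 0 c = 1) (j : ℕ) (c : Fin m → ℤ)
    (h : cubicalTower s g (j + 1) c ≠ 0) :
    (∃ a a' : Fin m → ℤ, (∀ i, |a i - c i| ≤ j + 1) ∧ (∀ i, |a' i - c i| ≤ j + 1) ∧
      g a = 0 ∧ g a' = 1) ∧
    ∀ l, l ≠ 0 → l ≤ j → ∃ v v' : Fin m → ℤ, (∀ i, |v i - c i| ≤ j + 1) ∧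
      (∀ i, |v' i - c i| ≤ j + 1) ∧ s l v = 0 ∧ s l v' = 1 := by
  induction j generalizing c with
  | zero =>
    refine ⟨?_, fun l h0 h1 => absurd (Nat.le_zero.1 h1) h0⟩
    have hone : cubicalCobdry (1 : (Fin m → ℤ) → ZMod 2) c = 0 := by
      refine Finset.sum_eq_zero fun k _ => ?_
      split_ifs
      · simp only [Pi.one_apply]; decide
      · rfl
    have h' : cubicalCobdry (g * 1) c ≠ 0 := by
      have : s 0 * cubicalTower s g 0 = g * 1 := by
        funext x
        simp [cubicalTower, hs0]
      rwa [cubicalTower, this] at h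
    obtain ⟨v, v', hv, hv', -, h0, h1⟩ := exists_faces_of_cubicalCobdry_mul_ne_zero hone h'
    exact ⟨v, v', by simpa using hv, by simpa using hv', h0, h1⟩
  | succ j ih =>
    obtain ⟨v, v', hv, hv', hg, h0, h1⟩ := exists_faces_of_cubicalCobdry_mul_ne_zero
      (cubicalCobdry_cubicalCobdry _ c) h
    have key : ∀ x : Fin m → ℤ, (∀ i, |x i - v' i| ≤ (j : ℤ) + 1) →
        ∀ i, |x i - c i| ≤ ((j + 1 : ℕ) : ℤ) + 1 := by
      intro x hx i
      have := abs_sub_le (x i) (v' i) (c i)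
      have h1 := hx i
      have h2 := hv' i
      push_cast
      linarith
    have key' : ∀ x : Fin m → ℤ, (∀ i, |x i - c i| ≤ 1) →
        ∀ i, |x i - c i| ≤ ((j + 1 : ℕ) : ℤ) + 1 := by
      intro x hx i
      have h1 := hx i
      push_cast
      linarith [(Nat.cast_nonneg j : (0 : ℤ) ≤ j)]
    obtain ⟨⟨a, a', ha, ha', hga, hga'⟩, hl⟩ := ih v' hg
    refine ⟨⟨a, a', key a ha, key a' ha', hga, hga'⟩, fun l hl0 hlj => ?_⟩
    rcases Nat.lt_or_ge j l with hjl | hjl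
    · obtain rfl : l = j + 1 := by omega
      exact ⟨v, v', key' v hv, key' v' hv', h0, h1⟩
    · obtain ⟨x, x', hx, hx', hs⟩ := hl l hl0 hjl
      exact ⟨x, x', key x hx, key x' hx', hs⟩

/-- The odd integers strictly between `2 p` and `2 q`. -/
def oddBetween (p q : ℤ) : Finset ℤ := (Finset.Ico p q).image fun k => 2 * k + 1

lemma mem_oddBetween {p q x : ℤ} : x ∈ oddBetween p q ↔ Odd x ∧ 2 * p < x ∧ x < 2 * q := by
  simp only [oddBetween, Finset.mem_image, Finset.mem_Ico]
  constructor
  · rintro ⟨k, ⟨h1, h2⟩, rfl⟩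
    exact ⟨⟨k, rfl⟩, by omega, by omega⟩
  · rintro ⟨⟨k, rfl⟩, h1, h2⟩
    exact ⟨k, ⟨by omega, by omega⟩, rfl⟩

lemma sum_oddBetween (u : ℤ → ZMod 2) (p : ℤ) (n : ℕ) :
    ∑ x ∈ oddBetween p (p + n), (u (x + 1) + u (x - 1)) = u (2 * p) + u (2 * (p + n)) := by
  rw [oddBetween, Finset.sum_image (fun a _ b _ h => by omega)]
  induction n with
  | zero =>
    simp only [Nat.cast_zero, add_zero, Finset.Ico_self, Finset.sum_empty]
    generalize u (2 * p) = a
    revert a; decide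
  | succ n ih =>
    have : Finset.Ico p (p + ((n + 1 : ℕ) : ℤ)) = insert (p + n) (Finset.Ico p (p + n)) := by
      ext x; simp only [Finset.mem_Ico, Finset.mem_insert]; omega
    rw [this, Finset.sum_insert (by simp), ih]
    have e1 : 2 * (p + (n : ℤ)) + 1 + 1 = 2 * (p + ((n + 1 : ℕ) : ℤ)) := by push_cast; ring
    have e2 : 2 * (p + (n : ℤ)) + 1 - 1 = 2 * (p + n) := by ring
    rw [e1, e2]
    generalize u (2 * p) = a
    generalize u _ = b
    generalize u _ = b'
    revert a b b'; decide

lemma sum_piFinset_eq_sum_update (t : Fin m → Finset ℤ) (i : Fin m)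
    (f : (Fin m → ℤ) → ZMod 2) :
    ∑ c ∈ Fintype.piFinset t, f c =
      ∑ c ∈ Fintype.piFinset (Function.update t i {0}), ∑ x ∈ t i, f (Function.update c i x) := by
  rw [← Finset.sum_product']
  refine Finset.sum_bij' (fun c _ => (Function.update c i 0, c i))
    (fun p _ => Function.update p.1 i p.2) ?_ ?_ ?_ ?_ ?_
  · intro c hc
    simp only [Fintype.mem_piFinset, Finset.mem_product] at hc ⊢
    refine ⟨fun k => ?_, hc i⟩
    by_cases hk : k = i
    · subst hk; simp
    · simp [hk, hc k]
  · rintro ⟨c, x⟩ hc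
    simp only [Fintype.mem_piFinset, Finset.mem_product] at hc ⊢
    intro k
    by_cases hk : k = i
    · subst hk; simpa using hc.2
    · simpa [hk] using hc.1 k
  · intro c _
    simp
  · rintro ⟨c, x⟩ hc
    simp only [Fintype.mem_piFinset, Finset.mem_product] at hc
    have := hc.1 i
    simp only [Function.update_self, Finset.mem_singleton] at this
    simp [← this]
  · intro c _
    simp

/-- The centres of the `j`-dimensional cubes in the coordinate subspace of the first `j`
coordinates, within the box of half width `2 n`. -/
def fullBox (m n j : ℕ) : Finset (Fin m → ℤ) :=
  Fintype.piFinset fun i => if i.val < j then oddBetween (-n) n else {0}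

/-- The centres of the `(j + 1)`-dimensional cubes in the half of the coordinate subspace of the
first `j + 1` coordinates on which coordinate `j` is positive, within the box of half width
`2 n`. -/
def halfBox (m n j : ℕ) : Finset (Fin m → ℤ) :=
  Fintype.piFinset fun i => if i.val < j then oddBetween (-n) n else
    if i.val = j then oddBetween 0 n else {0}

lemma sum_halfBox_cubicalCobdry {n j : ℕ} (hj : j < m) {f : (Fin m → ℤ) → ZMod 2}
    (hf : ∀ c i, c i = 2 * (n : ℤ) → f c = 0) (hf' : ∀ c i, c i = -(2 * (n : ℤ)) → f c = 0) :
    ∑ c ∈ halfBox m n j, cubicalCobdry f c = ∑ c ∈ fullBox m n j, f c := by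
  unfold cubicalCobdry
  rw [Finset.sum_comm, Finset.sum_eq_single (⟨j, hj⟩ : Fin m)]
  · rw [halfBox, sum_piFinset_eq_sum_update _ ⟨j, hj⟩]
    refine Finset.sum_congr ?_ fun c hc => ?_
    · rw [fullBox]
      congr 1
      funext i
      by_cases hi : i = ⟨j, hj⟩
      · subst hi; simp
      · have : i.val ≠ j := fun h => hi (Fin.ext h)
        simp [hi, this]
    · have hc0 : c ⟨j, hj⟩ = 0 := by
        simpa using (Fintype.mem_piFinset.1 hc) ⟨j, hj⟩
      have := sum_oddBetween (fun x => f (Function.update c ⟨j, hj⟩ x)) 0 n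
      simp only [zero_add, mul_zero] at this
      rw [hf (Function.update c ⟨j, hj⟩ (2 * (n : ℤ))) ⟨j, hj⟩ (by simp), add_zero] at this
      rw [← hc0, Function.update_eq_self] at this
      rw [← this, hc0]
      simp only [lt_irrefl, if_false, if_true]
      refine Finset.sum_congr rfl fun x hx => ?_
      simp [(mem_oddBetween.1 hx).1]
  · intro i _ hi
    have hij : i.val ≠ j := fun h => hi (Fin.ext h)
    by_cases hlt : i.val < j
    · rw [halfBox, sum_piFinset_eq_sum_update _ i]
      refine Finset.sum_eq_zero fun c _ => ?_
      have := sum_oddBetween (fun x => f (Function.update c i x)) (-n) (2 * n)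
      have e : (-n : ℤ) + ((2 * n : ℕ) : ℤ) = n := by push_cast; ring
      rw [e] at this
      rw [hf (Function.update c i (2 * (n : ℤ))) i (by simp),
        hf' (Function.update c i (2 * (-(n : ℤ)))) i (by simp), add_zero] at this
      rw [← this]
      simp only [hlt, if_true]
      refine Finset.sum_congr rfl fun x hx => ?_
      simp [(mem_oddBetween.1 hx).1]
    · refine Finset.sum_eq_zero fun c hc => ?_
      have := (Fintype.mem_piFinset.1 hc) i
      simp only [hlt, hij, if_false, Finset.mem_singleton] at this
      simp [this]
  · simp

lemma sum_fullBox_mul {n j : ℕ} (hj : j < m) {s g : (Fin m → ℤ) → ZMod 2}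
    (hs : ∀ c, c ≠ 0 → s (-c) = s c + 1) (hg : ∀ c, g (-c) = g c) :
    ∑ c ∈ fullBox m n (j + 1), (s * g) c = ∑ c ∈ halfBox m n j, g c := by
  have hpos : (fullBox m n (j + 1)).filter (fun c => 0 < c ⟨j, hj⟩) = halfBox m n j := by
    ext c
    simp only [fullBox, halfBox, Finset.mem_filter, Fintype.mem_piFinset]
    constructor
    · rintro ⟨h, h0⟩ i
      have hi := h i
      rcases lt_trichotomy i.val j with h1 | h1 | h1
      · simpa [h1, Nat.lt_succ_of_lt h1] using hi
      · obtain rfl : i = ⟨j, hj⟩ := Fin.ext h1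
        simp only [Nat.lt_succ_self, if_true, lt_irrefl, if_false, mem_oddBetween] at hi ⊢
        exact ⟨hi.1, by simpa using h0, hi.2.2⟩
      · have h2 : ¬ i.val < j + 1 := by omega
        have h3 : ¬ i.val < j := by omega
        have h4 : ¬ i.val = j := by omega
        simpa only [h2, h3, h4, if_false] using hi
    · intro h
      refine ⟨fun i => ?_, ?_⟩
      · have hi := h i
        rcases lt_trichotomy i.val j with h1 | h1 | h1
        · simpa [h1, Nat.lt_succ_of_lt h1] using hi
        · obtain rfl : i = ⟨j, hj⟩ := Fin.ext h1
          simp only [Nat.lt_succ_self, if_true, lt_irrefl, if_false, mem_oddBetween] at hi ⊢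
          exact ⟨hi.1, by omega, hi.2.2⟩
        · have h2 : ¬ i.val < j + 1 := by omega
          have h3 : ¬ i.val < j := by omega
          have h4 : ¬ i.val = j := by omega
          simpa only [h2, h3, h4, if_false] using hi
      · have := h ⟨j, hj⟩
        simp only [lt_irrefl, if_false, if_true, mem_oddBetween] at this
        simpa using this.2.1
  have hodd : ∀ c ∈ fullBox m n (j + 1), Odd (c ⟨j, hj⟩) := by
    intro c hc
    have := (Fintype.mem_piFinset.1 hc) ⟨j, hj⟩
    simp only [Nat.lt_succ_self, if_true, mem_oddBetween] at this
    exact this.1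
  have hneg : ∀ c ∈ fullBox m n (j + 1), -c ∈ fullBox m n (j + 1) := by
    intro c hc
    refine Fintype.mem_piFinset.2 fun i => ?_
    have := (Fintype.mem_piFinset.1 hc) i
    split_ifs at this ⊢
    · rw [mem_oddBetween] at this ⊢
      refine ⟨by simpa using this.1, ?_, ?_⟩ <;> simp only [Pi.neg_apply] <;> omega
    · simpa using this
  have hswap : ∑ c ∈ (fullBox m n (j + 1)).filter (fun c => ¬ 0 < c ⟨j, hj⟩), (s * g) c =
      ∑ c ∈ (fullBox m n (j + 1)).filter (fun c => 0 < c ⟨j, hj⟩), (s c + 1) * g c := by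
    refine Finset.sum_bij' (fun c _ => -c) (fun c _ => -c) ?_ ?_ (by simp) (by simp) ?_
    · intro c hc
      simp only [Finset.mem_filter] at hc ⊢
      refine ⟨hneg c hc.1, ?_⟩
      obtain ⟨k, hk⟩ := hodd c hc.1
      simp only [Pi.neg_apply]
      omega
    · intro c hc
      simp only [Finset.mem_filter] at hc ⊢
      refine ⟨hneg c hc.1, ?_⟩
      simp only [Pi.neg_apply]
      omega
    · intro c hc
      simp only [Finset.mem_filter] at hc
      have hc0 : -c ≠ 0 := by
        intro h
        have h2 := hodd c hc.1
        rw [neg_eq_zero.1 h] at h2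
        simp at h2
      rw [← hs _ hc0, neg_neg, hg, Pi.mul_apply]
  rw [← Finset.sum_filter_add_sum_filter_not _ (fun c => 0 < c ⟨j, hj⟩), hswap, hpos,
    ← Finset.sum_add_distrib]
  refine Finset.sum_congr rfl fun c _ => ?_
  simp only [Pi.mul_apply]
  generalize s c = a
  generalize g c = b
  revert a b; decide

lemma sum_halfBox_cubicalTower {n : ℕ} {s : ℕ → (Fin m → ℤ) → ZMod 2}
    {g : (Fin m → ℤ) → ZMod 2} (hg : ∀ c, g (-c) = g c) (hg0 : g 0 = 1)
    (hsupp : ∀ c i, |c i| = 2 * (n : ℤ) → g c = 0) (hs0 : ∀ c, s 0 c = 1)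
    (hs : ∀ j, j ≠ 0 → ∀ c, c ≠ 0 → s j (-c) = s j c + 1) {j : ℕ} (hj : j < m) :
    ∑ c ∈ halfBox m n j, cubicalTower s g (j + 1) c = 1 := by
  have hz : Even (2 * (n : ℤ)) := even_two_mul _
  have hzero : ∀ j c i, c i = 2 * (n : ℤ) → (s j * cubicalTower s g j) c = 0 := by
    intro j c i hc
    rw [Pi.mul_apply, cubicalTower_eq_zero hz
      (fun c i h => hsupp c i (by rw [h, abs_of_nonneg]; positivity)) j c i hc, mul_zero]
  have hzero' : ∀ j c i, c i = -(2 * (n : ℤ)) → (s j * cubicalTower s g j) c = 0 := by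
    intro j c i hc
    rw [Pi.mul_apply, cubicalTower_eq_zero hz.neg
      (fun c i h => hsupp c i (by rw [h, abs_neg, abs_of_nonneg]; positivity)) j c i hc, mul_zero]
  induction j with
  | zero =>
    rw [cubicalTower, sum_halfBox_cubicalCobdry hj (hzero 0) (hzero' 0)]
    have : fullBox m n 0 = {0} := by
      ext c
      simp [fullBox, funext_iff]
    simp [this, hs0, hg0, cubicalTower]
  | succ j ih =>
    rw [cubicalTower, sum_halfBox_cubicalCobdry hj (hzero _) (hzero' _),
      sum_fullBox_mul (by omega) (hs _ (by simp)) (cubicalTower_neg hg hs0 hs (j + 1))]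
    exact ih (by omega)

lemma exists_cubicalTower_ne_zero {n j : ℕ} {s : ℕ → (Fin (j + 1) → ℤ) → ZMod 2}
    {g : (Fin (j + 1) → ℤ) → ZMod 2} (hg : ∀ c, g (-c) = g c) (hg0 : g 0 = 1)
    (hsupp : ∀ c i, |c i| = 2 * (n : ℤ) → g c = 0) (hs0 : ∀ c, s 0 c = 1)
    (hs : ∀ j, j ≠ 0 → ∀ c, c ≠ 0 → s j (-c) = s j c + 1) :
    ∃ c, (∀ i, |c i| ≤ 2 * (n : ℤ)) ∧ cubicalTower s g (j + 1) c ≠ 0 := by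
  have h := sum_halfBox_cubicalTower hg hg0 hsupp hs0 hs (Nat.lt_succ_self j)
  obtain ⟨c, hc, hne⟩ := Finset.exists_ne_zero_of_sum_ne_zero (h.trans_ne one_ne_zero)
  refine ⟨c, fun i => ?_, hne⟩
  have := (Fintype.mem_piFinset.1 hc) i
  rw [abs_le]
  split_ifs at this
  · rw [mem_oddBetween] at this; omega
  · rw [mem_oddBetween] at this; omega
  · rw [Finset.mem_singleton] at this; omega

end Cubical

section OddEven

lemma exists_half_of_neg (m : ℕ) :
    ∃ pos : (Fin m → ℤ) → Prop, ∀ c, c ≠ 0 → (pos (-c) ↔ ¬ pos c) := by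
  classical
  refine ⟨fun c => ∃ i, 0 < c i ∧ ∀ j < i, c j = 0, fun c hc => ?_⟩
  have hex : ∃ i, c i ≠ 0 := by
    by_contra! h
    exact hc (funext h)
  obtain ⟨i, hi, hmin⟩ : ∃ i, c i ≠ 0 ∧ ∀ j < i, c j = 0 := by
    obtain ⟨i, hi⟩ := hex
    have hne : (Finset.univ.filter fun i => c i ≠ 0).Nonempty := ⟨i, by simpa using hi⟩
    refine ⟨_, (Finset.mem_filter.1 (Finset.min'_mem _ hne)).2, fun j hj => ?_⟩
    by_contra h
    exact hj.not_ge (Finset.min'_le _ _ (by simpa using h))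
  have key : ∀ b : Fin m → ℤ, b i ≠ 0 → (∀ j < i, b j = 0) →
      ((∃ i, 0 < b i ∧ ∀ j < i, b j = 0) ↔ 0 < b i) := by
    refine fun b hb hb' => ⟨fun ⟨l, hl, hl'⟩ => ?_, fun h => ⟨i, h, hb'⟩⟩
    rcases lt_trichotomy l i with h | h | h
    · exact absurd (hb' l h) hl.ne'
    · exact h ▸ hl
    · exact absurd (hl' i h) hb
  beta_reduce
  rw [key c hi hmin, key (-c) (by simpa using hi) (fun j hj => by simp [hmin j hj])]
  simp only [Pi.neg_apply]
  lia

lemma exists_near_zero_of_odd_of_even {d : ℕ} {F : (Fin (d + 1) → ℝ) → Fin d → ℝ}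
    (hodd : ∀ x, F (-x) = -F x) {G : (Fin (d + 1) → ℝ) → ℝ} (heven : ∀ x, G (-x) = G x)
    (hG0 : G 0 < 0) {R : ℝ} (hR0 : 0 < R) (hR : ∀ x, R ≤ ‖x‖ → 0 < G x) {n : ℕ} (hn : 0 < n) :
    ∃ x : Fin (d + 1) → ℝ, ‖x‖ ≤ R ∧
      (∃ a a', dist a x ≤ R / (2 * n) * (d + 1) ∧ dist a' x ≤ R / (2 * n) * (d + 1) ∧
        0 ≤ G a ∧ G a' < 0) ∧
      ∀ l : Fin d, ∃ v v', dist v x ≤ R / (2 * n) * (d + 1) ∧ dist v' x ≤ R / (2 * n) * (d + 1) ∧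
        F v l ≤ 0 ∧ 0 ≤ F v' l := by
  classical
  have hnR : (0 : ℝ) < n := by exact_mod_cast hn
  have hq : 0 < R / (2 * n) := by positivity
  let pt : (Fin (d + 1) → ℤ) → Fin (d + 1) → ℝ := fun c i => R / (2 * n) * c i
  have hptneg : ∀ c, pt (-c) = -pt c := fun c => by
    ext i; simp [pt]
  have hpt0 : pt 0 = 0 := by ext i; simp [pt]
  have hdist : ∀ v c : Fin (d + 1) → ℤ, (∀ i, |v i - c i| ≤ (d : ℤ) + 1) →
      dist (pt v) (pt c) ≤ R / (2 * n) * (d + 1) := by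
    intro v c h
    refine (dist_pi_le_iff (by positivity)).2 fun i => ?_
    rw [Real.dist_eq, ← mul_sub, abs_mul, abs_of_pos hq]
    refine mul_le_mul_of_nonneg_left ?_ hq.le
    exact_mod_cast h i
  let y : ℕ → (Fin (d + 1) → ℤ) → ℝ := fun l c =>
    if h : l - 1 < d then F (pt c) ⟨l - 1, h⟩ else 0
  have hyneg : ∀ l c, y l (-c) = -y l c := by
    intro l c
    by_cases h : l - 1 < d <;> simp [y, h, hptneg, hodd]
  let g : (Fin (d + 1) → ℤ) → ZMod 2 := fun c => if G (pt c) < 0 then 1 else 0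
  obtain ⟨pos, hpos⟩ := exists_half_of_neg (d + 1)
  let s : ℕ → (Fin (d + 1) → ℤ) → ZMod 2 := fun l c =>
    if l = 0 then 1 else if 0 < y l c ∨ (y l c = 0 ∧ pos c) then 1 else 0
  have hs : ∀ l, l ≠ 0 → ∀ c, c ≠ 0 → s l (-c) = s l c + 1 := by
    intro l hl c hc
    have h11 : (1 : ZMod 2) + 1 = 0 := by decide
    simp only [s, hl, if_false, hyneg, hpos c hc, Left.neg_pos_iff, neg_eq_zero]
    rcases lt_trichotomy (y l c) 0 with h | h | h
    · simp [h, h.ne, h.le]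
    · by_cases h' : pos c <;> simp [h, h', h11]
    · simp [h, h.ne', h.le, h11]
  obtain ⟨c, hc, hne⟩ := exists_cubicalTower_ne_zero (n := n) (s := s) (g := g)
    (fun c => by simp only [g, hptneg, heven])
    (by simp [g, hpt0, hG0])
    (fun c i hci => by
      have h1 : R ≤ ‖pt c‖ := by
        refine le_trans ?_ (norm_le_pi_norm (pt c) i)
        have : |(c i : ℝ)| = 2 * n := by exact_mod_cast hci
        rw [Real.norm_eq_abs, abs_mul, this, abs_of_pos hq]
        exact le_of_eq (by field_simp)
      simp only [g, if_neg (hR _ h1).le.not_gt])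
    (fun c => by simp [s]) hs
  obtain ⟨⟨a, a', ha, ha', hga, hga'⟩, hl⟩ :=
    exists_near_of_cubicalTower_ne_zero (fun c => by simp [s]) d c hne
  refine ⟨pt c, ?_, ⟨pt a, pt a', hdist a c ha, hdist a' c ha', ?_, ?_⟩, fun l => ?_⟩
  · refine (pi_norm_le_iff_of_nonneg hR0.le).2 fun i => ?_
    have : |(c i : ℝ)| ≤ 2 * n := by exact_mod_cast hc i
    rw [Real.norm_eq_abs, abs_mul, abs_of_pos hq]
    calc R / (2 * n) * |(c i : ℝ)| ≤ R / (2 * n) * (2 * n) := by gcongr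
      _ = R := by field_simp
  · by_contra! h
    simp [g, h] at hga
  · by_contra h
    simp [g, h] at hga'
  · obtain ⟨v, v', hv, hv', hsv, hsv'⟩ := hl (l + 1) (by simp) (by have := l.2; omega)
    have hy : ∀ c, y (l + 1) c = F (pt c) l := fun c => by simp [y]
    refine ⟨pt v, pt v', hdist v c hv, hdist v' c hv', ?_, ?_⟩
    · by_contra! h
      rw [← hy] at h
      simp [s, h] at hsv
    · by_contra! h
      rw [← hy] at h
      simp [s, h.ne, h.le.not_gt] at hsv'

/-- A parametrised form of the Borsuk-Ulam theorem: an odd map to a space of one dimension less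
and an even function which is negative at the origin and positive far away have a common zero. -/
theorem exists_common_zero_of_odd_of_even {d : ℕ} {F : (Fin (d + 1) → ℝ) → Fin d → ℝ}
    (hF : Continuous F) (hodd : ∀ x, F (-x) = -F x) {G : (Fin (d + 1) → ℝ) → ℝ}
    (hG : Continuous G) (heven : ∀ x, G (-x) = G x) (hG0 : G 0 < 0) {R : ℝ}
    (hR : ∀ x, R ≤ ‖x‖ → 0 < G x) : ∃ x, F x = 0 ∧ G x = 0 := by
  have hR0 : 0 < R := by
    by_contra! h
    exact hG0.not_gt (hR 0 (by simpa using h))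
  choose x hx a hl using fun n : ℕ =>
    exists_near_zero_of_odd_of_even hodd heven hG0 hR0 hR n.succ_pos
  choose a a' ha ha' hGa hGa' using a
  choose v v' hv hv' hFv hFv' using hl
  obtain ⟨z, -, θ, hθ, hz⟩ := (isCompact_closedBall (0 : Fin (d + 1) → ℝ) R).tendsto_subseq
    (x := x) (fun n => by simpa using hx n)
  have hsmall : Tendsto (fun n : ℕ => R / (2 * ((n + 1 : ℕ) : ℝ)) * ((d : ℝ) + 1)) atTop (𝓝 0) := by
    have h1 : Tendsto (fun n : ℕ => (((n + 1 : ℕ) : ℝ))⁻¹) atTop (𝓝 0) :=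
      (tendsto_inv_atTop_nhds_zero_nat (𝕜 := ℝ)).comp (tendsto_add_atTop_nat 1)
    have h2 := h1.const_mul (R / 2 * ((d : ℝ) + 1))
    rw [mul_zero] at h2
    refine h2.congr fun n => ?_
    field_simp
  have hlim : ∀ u : ℕ → Fin (d + 1) → ℝ,
      (∀ n, dist (u n) (x n) ≤ R / (2 * ((n + 1 : ℕ) : ℝ)) * ((d : ℝ) + 1)) →
      Tendsto (u ∘ θ) atTop (𝓝 z) := by
    intro u hu
    refine hz.congr_dist ?_
    have := squeeze_zero (fun n => dist_nonneg) hu hsmall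
    refine (this.comp hθ.tendsto_atTop).congr fun n => ?_
    simp [dist_comm]
  refine ⟨z, funext fun l => le_antisymm ?_ ?_, le_antisymm ?_ ?_⟩
  · exact le_of_tendsto' ((((continuous_apply l).comp hF).tendsto z).comp
      (hlim _ fun n => hv n l)) fun n => hFv (θ n) l
  · exact ge_of_tendsto' ((((continuous_apply l).comp hF).tendsto z).comp
      (hlim _ fun n => hv' n l)) fun n => hFv' (θ n) l
  · exact le_of_tendsto' ((hG.tendsto z).comp (hlim _ ha')) fun n => (hGa' (θ n)).le
  · exact ge_of_tendsto' ((hG.tendsto z).comp (hlim _ ha)) fun n => hGa (θ n)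

end OddEven


section Variational

/-- Ekeland's variational principle. -/
theorem LowerSemicontinuous.exists_forall_sub_mul_dist_lt {α : Type*} [MetricSpace α]
    [CompleteSpace α] [Nonempty α] {J : α → ℝ} (hJ : LowerSemicontinuous J)
    (hb : BddBelow (range J)) {ε : ℝ} (hε : 0 < ε) :
    ∃ x, ∀ y, y ≠ x → J x - ε * dist x y < J y := by
  by_contra! hcon
  let A : α → Set α := fun x => {y | J y + ε * dist x y ≤ J x}
  have hself : ∀ x, x ∈ A x := fun x => by simp [A]
  have htrans : ∀ {x y z}, y ∈ A x → z ∈ A y → z ∈ A x := by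
    intro x y z hy hz
    have := mul_le_mul_of_nonneg_left (dist_triangle x y z) hε.le
    simp only [A, mem_ofPred_eq] at hy hz ⊢
    linarith
  have hbA : ∀ x, BddBelow (J '' A x) := fun x => hb.mono (image_subset_range _ _)
  have hnext : ∀ x, ∃ y ∈ A x, 2 * J y ≤ J x + sInf (J '' A x) := by
    intro x
    have hle : sInf (J '' A x) ≤ J x := csInf_le (hbA x) (mem_image_of_mem J (hself x))
    rcases hle.lt_or_eq with h | h
    · obtain ⟨-, ⟨y, hy, rfl⟩, hlt⟩ := exists_lt_of_csInf_lt (Set.Nonempty.image J ⟨x, hself x⟩)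
        (show sInf (J '' A x) < (J x + sInf (J '' A x)) / 2 by linarith)
      exact ⟨y, hy, by linarith⟩
    · exact ⟨x, hself x, by linarith⟩
  choose next hnextA hnextJ using hnext
  let u : ℕ → α := fun n => next^[n] (Classical.arbitrary α)
  have hu : ∀ n, u (n + 1) = next (u n) := fun n => Function.iterate_succ_apply' _ _ _
  have huA : ∀ n m, n ≤ m → u m ∈ A (u n) := by
    intro n m h
    induction m, h using Nat.le_induction with
    | base => exact hself _
    | succ m _ ih => exact htrans ih (hu m ▸ hnextA _)
  have hanti : Antitone (J ∘ u) := antitone_nat_of_succ_le fun n => by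
    have h1 := huA n (n + 1) n.le_succ
    have h2 : 0 ≤ ε * dist (u n) (u (n + 1)) := by positivity
    simp only [A, mem_ofPred_eq] at h1
    simp only [Function.comp_apply]
    linarith
  have hbu : BddBelow (range (J ∘ u)) := hb.mono (range_comp_subset_range _ _)
  have hlim := tendsto_atTop_ciInf hanti hbu
  set L := ⨅ n, (J ∘ u) n with hL
  have hLle : ∀ n, L ≤ J (u n) := fun n => ciInf_le hbu n
  have hcau : CauchySeq u := by
    refine cauchySeq_of_le_tendsto_0' (fun n => (J (u n) - L) / ε) (fun n m h => ?_) ?_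
    · rw [le_div_iff₀ hε]
      have h1 := huA n m h
      have h2 := hLle m
      simp only [A, mem_ofPred_eq] at h1
      linarith
    · have := (hlim.sub_const L).div_const ε
      simpa using this
  obtain ⟨z, hz⟩ := cauchySeq_tendsto_of_complete hcau
  have hJz : J z ≤ L := by
    by_contra! h
    obtain ⟨r, hr, hr'⟩ := exists_between h
    have h1 : ∀ᶠ n in atTop, r < J (u n) := hz.eventually (hJ z r hr')
    exact hr.not_ge (ge_of_tendsto hlim (h1.mono fun n h => h.le))
  have hzA : ∀ n, z ∈ A (u n) := by
    intro n
    have h1 : Tendsto (fun m => J (u n) - ε * dist (u n) (u m)) atTop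
        (𝓝 (J (u n) - ε * dist (u n) z)) := ((tendsto_const_nhds.dist hz).const_mul ε).const_sub _
    have h2 : L ≤ J (u n) - ε * dist (u n) z := by
      refine le_of_tendsto_of_tendsto hlim h1 ((eventually_ge_atTop n).mono fun m h => ?_)
      have := huA n m h
      simp only [A, mem_ofPred_eq, Function.comp_apply] at this ⊢
      linarith
    simp only [A, mem_ofPred_eq]
    linarith
  obtain ⟨y, hyz, hy⟩ := hcon z
  have hyA : y ∈ A z := by
    simp only [A, mem_ofPred_eq]
    linarith
  have h1 : ∀ n, 2 * J (u (n + 1)) - J (u n) ≤ J y := fun n => by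
    have h2 := csInf_le (hbA (u n)) (mem_image_of_mem J (htrans (hzA n) hyA))
    have h3 := hnextJ (u n)
    rw [← hu] at h3
    linarith
  have h2 := (((hlim.comp (tendsto_add_atTop_nat 1)).const_mul 2).sub hlim)
  have h3 := le_of_tendsto' h2 h1
  have h4 : 0 < ε * dist z y := mul_pos hε (dist_pos.2 hyz.symm)
  linarith

variable {X : Type*} [NormedAddCommGroup X] [InnerProductSpace ℝ X]

lemma exists_sub_eq_fderiv_apply {φ : X → ℝ} {φ' : X → X →L[ℝ] ℝ}
    (hderiv : ∀ u, HasFDerivAt φ (φ' u) u) (u v : X) :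
    ∃ s ∈ Icc (0 : ℝ) 1, φ (u + v) - φ u = φ' (u + s • v) v := by
  have h : ∀ s : ℝ, HasDerivAt (fun s : ℝ => φ (u + s • v)) (φ' (u + s • v) v) s := by
    intro s
    have h1 : HasDerivAt (fun s : ℝ => u + s • v) v s := by
      simpa using ((hasDerivAt_id s).smul_const v).const_add u
    exact (hderiv _).comp_hasDerivAt s h1
  obtain ⟨s, hs, hs'⟩ := exists_hasDerivAt_eq_slope (fun s : ℝ => φ (u + s • v)) _ zero_lt_one
    (fun s _ => (h s).continuousAt.continuousWithinAt) (fun s _ => h s)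
  refine ⟨s, Ioo_subset_Icc_self hs, ?_⟩
  simpa using hs'.symm

lemma fderiv_neg_of_even {φ : X → ℝ} {φ' : X → X →L[ℝ] ℝ}
    (hderiv : ∀ u, HasFDerivAt φ (φ' u) u) (heven : ∀ u, φ (-u) = φ u) (u : X) :
    φ' (-u) = -φ' u := by
  have h1 : HasFDerivAt (fun v => φ (-v)) ((φ' (-u)).comp (-ContinuousLinearMap.id ℝ X)) u :=
    (hderiv (-u)).comp u (hasFDerivAt_id u).neg
  simp only [heven] at h1
  have h2 := h1.unique (hderiv u)
  ext v
  have := DFunLike.congr_fun h2 v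
  simp at this ⊢
  linarith

variable {K : Type*} [TopologicalSpace K]

lemma WeaklySeqContDeriv.continuous_apply [FirstCountableTopology K] {φ' : X → X →L[ℝ] ℝ}
    (hwsc : WeaklySeqContDeriv φ') {ι : K → X} (hι : ∀ w, Continuous fun a => ⟪ι a, w⟫)
    (κ : C(K, X)) (w : X) : Continuous fun p : K × X => φ' (ι p.1 + κ p.1 + p.2) w := by
  refine SeqContinuous.continuous fun p q hp => hwsc _ _ (fun v => ?_) w
  have h : Continuous fun p : K × X => ⟪ι p.1, v⟫ + ⟪κ p.1 + p.2, v⟫ := by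
    have h1 : Continuous fun p : K × X => ⟪κ p.1 + p.2, v⟫ := by fun_prop
    exact ((hι v).comp continuous_fst).add h1
  have h2 := (h.tendsto q).comp hp
  simpa only [← inner_add_left, add_assoc, Function.comp_def] using h2

/-- On a compact subset of the parameter space where `φ'` is bounded below in norm there is an odd
descent field. -/
lemma exists_odd_descent [CompactSpace K] [T2Space K] [FirstCountableTopology K]
    {φ : X → ℝ} {φ' : X → X →L[ℝ] ℝ} (hderiv : ∀ u, HasFDerivAt φ (φ' u) u)
    (heven : ∀ u, φ (-u) = φ u) (hwsc : WeaklySeqContDeriv φ')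
    {ν : C(K, K)} (hνν : ∀ a, ν (ν a) = a) {ι : K → X} (hι : ∀ w, Continuous fun a => ⟪ι a, w⟫)
    (hιν : ∀ a, ι (ν a) = -ι a) {κ : C(K, X)} (hκ : ∀ a, κ (ν a) = -κ a)
    {D : Set K} (hD : IsClosed D) {ε : ℝ} (hε : 0 < ε) (hDε : ∀ a ∈ D, ε < ‖φ' (ι a + κ a)‖) :
    ∃ (W : C(K, X)) (h₀ : ℝ), 0 < h₀ ∧ (∀ a, W (ν a) = -W a) ∧ (∀ a, ‖W a‖ ≤ 1) ∧
      ∀ h ∈ Icc 0 h₀, (∀ a, φ (ι a + (κ - h • W) a) ≤ φ (ι a + κ a)) ∧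
        ∀ a ∈ D, φ (ι a + (κ - h • W) a) ≤ φ (ι a + κ a) - h * (ε / 2) := by
  classical
  have hloc : ∀ x : D, ∃ (w : X) (O : Set K) (h : ℝ), ‖w‖ ≤ 1 ∧ IsOpen O ∧ (x : K) ∈ O ∧ 0 < h ∧
      ∀ y ∈ O, ∀ v : X, ‖v‖ ≤ h → ε ≤ φ' (ι y + κ y + v) w := by
    rintro ⟨x, hx⟩
    obtain ⟨w, hw, hwε⟩ : ∃ w : X, ‖w‖ ≤ 1 ∧ ε < φ' (ι x + κ x) w := by
      obtain ⟨w, hw, hwε⟩ := (φ' (ι x + κ x)).exists_lt_apply_of_lt_opNorm (hDε x hx)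
      rcases lt_abs.1 hwε with h | h
      · exact ⟨w, hw.le, h⟩
      · exact ⟨-w, by simpa using hw.le, by simpa using h⟩
    have h1 : ∀ᶠ p : K × X in 𝓝 (x, 0), ε < φ' (ι p.1 + κ p.1 + p.2) w :=
      ((hwsc.continuous_apply hι κ w).tendsto (x, 0)).eventually
        (lt_mem_nhds (by simpa using hwε))
    rw [nhds_prod_eq] at h1
    obtain ⟨p, hp, q, hq, hpq⟩ := eventually_prod_iff.1 h1
    obtain ⟨O, hO, hOo, hxO⟩ := eventually_nhds_iff.1 hp
    obtain ⟨h, hh, hball⟩ := Metric.eventually_nhds_iff.1 hq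
    exact ⟨w, O, h / 2, hw, hOo, hxO, by positivity, fun y hy v hv =>
      (hpq (hO y hy) (hball (by simpa using hv.trans_lt (by linarith)))).le⟩
  choose w O h₁ hw hO hxO hh₁ hdesc using hloc
  obtain ⟨t, ht⟩ := hD.isCompact.elim_finite_subcover O hO
    fun x hx => mem_iUnion.2 ⟨⟨x, hx⟩, hxO _⟩
  obtain ⟨χ, hχ⟩ := PartitionOfUnity.exists_isSubordinate hD (fun i : t => O i) (fun i => hO i)
    (ht.trans fun x hx => by simpa using hx)
  have hχO : ∀ (i : t) a, χ i a ≠ 0 → a ∈ O i := fun i a h => hχ i (subset_tsupport _ h)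
  have hsum_le : ∀ a, ∑ i, χ i a ≤ 1 := fun a => by
    simpa [finsum_eq_sum_of_fintype] using χ.sum_le_one a
  have hsum : ∀ a ∈ D, ∑ i, χ i a = 1 := fun a ha => by
    simpa [finsum_eq_sum_of_fintype] using χ.sum_eq_one ha
  obtain ⟨h₀, hh₀, hle⟩ : ∃ h₀, 0 < h₀ ∧ ∀ i : t, h₀ ≤ h₁ i := by
    obtain ⟨h, hh⟩ := Finite.exists_min (fun i : Option t => i.elim 1 fun i => h₁ i)
    refine ⟨_, ?_, fun i => hh (some i)⟩
    cases h with
    | none => exact one_pos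
    | some i => exact hh₁ i
  let V : C(K, X) := ⟨fun a => ∑ i : t, χ i a • w i, by fun_prop⟩
  have hV : ∀ a, ‖V a‖ ≤ 1 := fun a => by
    calc ‖V a‖ ≤ ∑ i : t, ‖χ i a • w i‖ := norm_sum_le _ _
      _ ≤ ∑ i : t, χ i a := Finset.sum_le_sum fun i _ => by
          rw [norm_smul, Real.norm_of_nonneg (χ.nonneg i a)]
          exact mul_le_of_le_one_right (χ.nonneg i a) (hw i)
      _ ≤ 1 := hsum_le a
  have hVdesc : ∀ a v, ‖v‖ ≤ h₀ → ε * ∑ i, χ i a ≤ φ' (ι a + κ a + v) (V a) := by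
    intro a v hv
    simp only [V, ContinuousMap.coe_mk, map_sum, map_smul, smul_eq_mul, Finset.mul_sum]
    refine Finset.sum_le_sum fun i _ => ?_
    by_cases h : χ i a = 0
    · simp [h]
    · rw [mul_comm]
      exact mul_le_mul_of_nonneg_left (hdesc i a (hχO i a h) v (hv.trans (hle i)))
        (χ.nonneg i a)
  let W : C(K, X) := (1 / 2 : ℝ) • (V - V.comp ν)
  have hW : ∀ a, W a = (1 / 2 : ℝ) • (V a - V (ν a)) := fun a => rfl
  have hW1 : ∀ a, ‖W a‖ ≤ 1 := fun a => by
    rw [hW, norm_smul]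
    have := norm_sub_le (V a) (V (ν a))
    have h1 := hV a
    have h2 := hV (ν a)
    norm_num
    linarith
  have hmain : ∀ h ∈ Icc 0 h₀, ∀ a, φ (ι a + (κ - h • W) a) ≤
      φ (ι a + κ a) - h * (ε / 2 * (∑ i, χ i a + ∑ i, χ i (ν a))) := by
    intro h hh a
    obtain ⟨s, hs, hs'⟩ := exists_sub_eq_fderiv_apply hderiv (ι a + κ a) (-(h • W a))
    have h1 : ι a + (κ - h • W) a = ι a + κ a + -(h • W a) := by
      simp only [ContinuousMap.sub_apply, ContinuousMap.smul_apply]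
      abel
    rw [h1]
    have hv : ‖s • -(h • W a)‖ ≤ h₀ := by
      rw [norm_smul, norm_neg, norm_smul, Real.norm_of_nonneg hs.1, Real.norm_of_nonneg hh.1]
      calc s * (h * ‖W a‖) ≤ 1 * (h * 1) := by
            gcongr
            exacts [mul_nonneg hh.1 (norm_nonneg _), hs.2, hh.1, hW1 a]
        _ ≤ h₀ := by simpa using hh.2
    set v := s • -(h • W a) with hvdef
    have h2 := hVdesc a v hv
    have h3 := hVdesc (ν a) (-v) (by simpa using hv)
    have h4 : ι (ν a) + κ (ν a) + -v = -(ι a + κ a + v) := by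
      rw [hιν, hκ]; abel
    rw [h4, fderiv_neg_of_even hderiv heven] at h3
    have h5 : φ' (ι a + κ a + v) (-(h • W a)) =
        -(h * (1 / 2 * (φ' (ι a + κ a + v) (V a) - φ' (ι a + κ a + v) (V (ν a))))) := by
      rw [map_neg, map_smul, hW, map_smul, map_sub]; rfl
    rw [h5] at hs'
    simp only [neg_apply] at h3
    nlinarith [mul_le_mul_of_nonneg_left (add_le_add h2 h3) hh.1]
  have hnn : ∀ a, 0 ≤ ∑ i, χ i a := fun a => Finset.sum_nonneg fun i _ => χ.nonneg i a
  refine ⟨W, h₀, hh₀, fun a => ?_, hW1, fun h hh => ⟨fun a => ?_, fun a ha => ?_⟩⟩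
  · rw [hW, hW, hνν, ← smul_neg, neg_sub]
  · have h1 := hmain h hh a
    have : 0 ≤ h * (ε / 2 * (∑ i, χ i a + ∑ i, χ i (ν a))) :=
      mul_nonneg hh.1 (mul_nonneg (by positivity) (add_nonneg (hnn a) (hnn _)))
    linarith
  · have h1 := hmain h hh a
    have : h * (ε / 2) ≤ h * (ε / 2 * (∑ i, χ i a + ∑ i, χ i (ν a))) := by
      refine mul_le_mul_of_nonneg_left (le_mul_of_one_le_right (by positivity) ?_) hh.1
      rw [hsum a ha]
      linarith [hnn (ν a)]
    linarith

/-- A minimax principle for even functionals over odd perturbations of a weakly continuous family: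
if a sublevel set of a functional `N` does not meet the linking level, there are almost critical
points outside of it. -/
theorem exists_almost_critical_of_linking [CompleteSpace X] [CompactSpace K] [T2Space K]
    [FirstCountableTopology K]
    {φ : X → ℝ} {φ' : X → X →L[ℝ] ℝ} (hderiv : ∀ u, HasFDerivAt φ (φ' u) u)
    (heven : ∀ u, φ (-u) = φ u) (hwsc : WeaklySeqContDeriv φ')
    {ν : C(K, K)} (hνν : ∀ a, ν (ν a) = a) {ι : K → X} (hι : ∀ w, Continuous fun a => ⟪ι a, w⟫)
    (hιν : ∀ a, ι (ν a) = -ι a) {d : ℝ} (hd : ∀ a, φ (ι a) ≤ d)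
    {N : X → ℝ} (hN : ∀ κ : C(K, X), Continuous fun a => N (ι a + κ a)) {δ c c' : ℝ} (hc : c < c')
    (hNδ : ∀ u, N u < δ → φ u ≤ c)
    (hlink : ∀ κ : C(K, X), (∀ a, κ (ν a) = -κ a) → (∀ a, φ (ι a + κ a) ≤ φ (ι a)) →
      ∃ a, c' ≤ φ (ι a + κ a)) {ε : ℝ} (hε : 0 < ε) :
    ∃ u, φ u ≤ d ∧ δ ≤ N u ∧ ‖φ' u‖ ≤ ε := by
  by_contra! hcon
  have hφc : Continuous φ := continuous_iff_continuousAt.2 fun u => (hderiv u).continuousAt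
  let Γ : Set C(K, X) := {κ | (∀ a, κ (ν a) = -κ a) ∧ ∀ a, φ (ι a + κ a) ≤ φ (ι a)}
  have hΓ : IsClosed Γ := by
    refine IsClosed.inter (s₁ := {κ : C(K, X) | ∀ a, κ (ν a) = -κ a})
      (s₂ := {κ | ∀ a, φ (ι a + κ a) ≤ φ (ι a)}) ?_ ?_
    · simp only [ofPred_forall]
      exact isClosed_iInter fun a => isClosed_eq (by fun_prop) (by fun_prop)
    · simp only [ofPred_forall]
      exact isClosed_iInter fun a => isClosed_le (by fun_prop) (by fun_prop)
  have : CompleteSpace Γ := hΓ.completeSpace_coe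
  have : Nonempty Γ := ⟨⟨0, by simp [Γ]⟩⟩
  have hΓd : ∀ (κ : Γ) a, φ (ι a + κ.1 a) ≤ d := fun κ a => (κ.2.2 a).trans (hd a)
  have hbdd : ∀ κ : Γ, BddAbove (range fun a => φ (ι a + κ.1 a)) := fun κ =>
    ⟨d, forall_mem_range.2 (hΓd κ)⟩
  let J : Γ → ℝ := fun κ => ⨆ a, φ (ι a + κ.1 a)
  have hJc' : ∀ κ, c' ≤ J κ := fun κ => by
    obtain ⟨a, ha⟩ := hlink κ.1 κ.2.1 κ.2.2
    exact ha.trans (le_ciSup (hbdd κ) a)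
  obtain ⟨a₀, -⟩ := hlink 0 (by simp) (by simp)
  have : Nonempty K := ⟨a₀⟩
  have hJ : LowerSemicontinuous J := lowerSemicontinuous_ciSup hbdd fun a =>
    (show Continuous fun κ : Γ => φ (ι a + κ.1 a) by fun_prop).lowerSemicontinuous
  obtain ⟨κ, hκ⟩ := hJ.exists_forall_sub_mul_dist_lt ⟨c', forall_mem_range.2 hJc'⟩
    (show 0 < ε / 4 by positivity)
  have hD : IsClosed {a | δ ≤ N (ι a + κ.1 a)} := isClosed_le continuous_const (hN κ.1)
  obtain ⟨W, h₀, hh₀, hWν, hW1, hdesc⟩ := exists_odd_descent hderiv heven hwsc hνν hι hιν κ.2.1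
    hD hε fun a ha => hcon _ (hΓd κ a) ha
  have hgap : 0 < J κ - c := by linarith [hJc' κ]
  obtain ⟨h, hh, hhh₀, hhgap⟩ : ∃ h, 0 < h ∧ h ≤ h₀ ∧ h * (ε / 2) ≤ J κ - c :=
    ⟨min h₀ ((J κ - c) / (ε / 2)), lt_min hh₀ (by positivity), min_le_left _ _,
      (le_div_iff₀ (by positivity)).1 (min_le_right _ _)⟩
  obtain ⟨hdesc₁, hdesc₂⟩ := hdesc h ⟨hh.le, hhh₀⟩
  let κ' : Γ := ⟨κ.1 - h • W, fun a => by
      simp only [ContinuousMap.sub_apply, ContinuousMap.smul_apply, κ.2.1 a, hWν, smul_neg]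
      abel, fun a => (hdesc₁ a).trans (κ.2.2 a)⟩
  have hJκ' : J κ' ≤ J κ - h * (ε / 2) := by
    refine ciSup_le fun a => ?_
    by_cases ha : δ ≤ N (ι a + κ.1 a)
    · exact (hdesc₂ a ha).trans (sub_le_sub_right (le_ciSup (hbdd κ) a) _)
    · have := (hdesc₁ a).trans (hNδ _ (not_le.1 ha))
      exact this.trans (by linarith)
  have hpos : 0 < h * (ε / 2) := by positivity
  have hdist : dist κ κ' ≤ h := by
    rw [Subtype.dist_eq, dist_eq_norm, sub_sub_cancel, norm_smul, Real.norm_of_nonneg hh.le]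
    exact mul_le_of_le_one_right hh.le ((ContinuousMap.norm_le _ zero_le_one).2 hW1)
  have := hκ κ' (by rintro h; rw [h] at hJκ'; linarith)
  nlinarith

end Variational

section SeqBall

/-- The closed ball of radius `ρ` of `ℓ²`, as a subset of the product space `ℕ → ℝ`. -/
def seqBall (ρ : ℝ) : Set (ℕ → ℝ) := {a | ∀ n, ∑ i ∈ Finset.range n, a i ^ 2 ≤ ρ ^ 2}

variable {ρ : ℝ}

lemma isCompact_seqBall : IsCompact (seqBall ρ) := by
  refine (isCompact_univ_pi fun _ : ℕ => isCompact_Icc (a := -|ρ|) (b := |ρ|)).of_isClosed_subset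
    ?_ fun a ha i _ => ?_
  · simp only [seqBall, ofPred_forall]
    exact isClosed_iInter fun n => isClosed_le (by fun_prop) continuous_const
  · refine abs_le.1 (sq_le_sq.1 (le_trans ?_ (ha (i + 1))))
    exact Finset.single_le_sum (f := fun i => a i ^ 2) (fun _ _ => sq_nonneg _)
      (Finset.self_mem_range_succ i)

instance : CompactSpace (seqBall ρ) := isCompact_iff_compactSpace.1 isCompact_seqBall

/-- The symmetry `a ↦ -a` of `seqBall ρ`. -/
def seqBallNeg (ρ : ℝ) : C(seqBall ρ, seqBall ρ) where
  toFun a := ⟨-a.1, fun n => by simpa using a.2 n⟩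
  continuous_toFun := by fun_prop

variable {X : Type*} [NormedAddCommGroup X] [InnerProductSpace ℝ X]

/-- The vector with coefficients `a` along the family `g`. -/
def synth (g : ℕ → X) (a : ℕ → ℝ) : X := ∑' i, a i • g i

lemma synth_neg (g : ℕ → X) (a : ℕ → ℝ) : synth g (-a) = -synth g a := by
  simp [synth, tsum_neg]

variable {g : ℕ → X}

lemma Orthonormal.inner_mem_seqBall (hg : Orthonormal ℝ g) {u : X} (hu : ‖u‖ ≤ ρ) :
    (fun i => ⟪g i, u⟫) ∈ seqBall ρ := fun n => by
  have h := hg.sum_inner_products_le u (s := Finset.range n)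
  simp only [Real.norm_eq_abs, sq_abs] at h
  exact h.trans (by gcongr)

lemma Orthonormal.norm_sum_smul_le (hg : Orthonormal ℝ g) (hρ : 0 ≤ ρ) {a : ℕ → ℝ}
    (ha : a ∈ seqBall ρ) (n : ℕ) : ‖∑ i ∈ Finset.range n, a i • g i‖ ≤ ρ := by
  refine (sq_le_sq₀ (norm_nonneg _) hρ).1 ?_
  rw [← real_inner_self_eq_norm_sq, hg.inner_sum]
  simpa [← sq] using ha n

/-- A finite-dimensional intersection property of odd perturbations of the family `synth g`. -/
lemma Orthonormal.exists_link_of_finite (hg : Orthonormal ℝ g) (hρ : 0 < ρ) {r : ℝ} (hr : 0 < r)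
    {κ : C(seqBall ρ, X)} (hκ : ∀ a, κ (seqBallNeg ρ a) = -κ a) (d : ℕ) :
    ∃ a : seqBall ρ, (∀ i, d < i → a.1 i = 0) ∧
      (∀ i, i ≠ 0 → i ≤ d → ⟪g i, synth g a + κ a⟫ = 0) ∧ ‖synth g a + κ a‖ ≤ r ∧
      (‖synth g a + κ a‖ = r ∨ ‖synth g a‖ = ρ) := by
  let v : (Fin (d + 1) → ℝ) → X := fun x => ∑ i, x i • g i
  let t : (Fin (d + 1) → ℝ) → ℝ := fun x => ρ / max ρ ‖v x‖
  have hmax : ∀ x, 0 < max ρ ‖v x‖ := fun x => lt_max_of_lt_left hρ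
  have hvc : Continuous v := by fun_prop
  have htc : Continuous t := continuous_const.div (by fun_prop) fun x => (hmax x).ne'
  have hvneg : ∀ x, v (-x) = -v x := fun x => by simp [v]
  have htneg : ∀ x, t (-x) = t x := fun x => by simp [t, hvneg]
  have htv : ∀ x, ‖t x • v x‖ ≤ ρ := fun x => by
    rw [norm_smul, Real.norm_of_nonneg (div_nonneg hρ.le (hmax x).le), div_mul_eq_mul_div,
      div_le_iff₀ (hmax x)]
    exact mul_le_mul_of_nonneg_left (le_max_right _ _) hρ.le
  let emb : (Fin (d + 1) → ℝ) → seqBall ρ := fun x =>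
    ⟨fun i => ⟪g i, t x • v x⟫, hg.inner_mem_seqBall (htv x)⟩
  have hembc : Continuous emb :=
    Continuous.subtype_mk (continuous_pi fun i => by fun_prop) _
  have hembneg : ∀ x, emb (-x) = seqBallNeg ρ (emb x) := fun x => by
    refine Subtype.ext (funext fun i => ?_)
    simp [emb, seqBallNeg, htneg, hvneg]
  have hvi : ∀ x (i : Fin (d + 1)), ⟪g i, v x⟫ = x i := fun x i =>
    (hg.comp (fun i : Fin (d + 1) => (i : ℕ)) Fin.val_injective).inner_right_fintype x i
  have hemb0 : ∀ x i, d < i → (emb x).1 i = 0 := fun x i hi => by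
    simp only [emb, v, inner_smul_right, inner_sum]
    refine mul_eq_zero_of_right _ (Finset.sum_eq_zero fun j _ => ?_)
    rw [hg.2 (by have := j.2; omega), mul_zero]
  have hsynth : ∀ x, synth g (emb x) = t x • v x := fun x => by
    rw [synth, tsum_eq_sum (s := Finset.range (d + 1)), Finset.sum_range]
    · simp only [emb, hvi, v, Finset.smul_sum, smul_smul]
    · intro i hi
      rw [hemb0 x i (by simpa using hi), zero_smul]
  let γ : (Fin (d + 1) → ℝ) → X := fun x => t x • v x + κ (emb x)
  have hγc : Continuous γ := by fun_prop
  have hγneg : ∀ x, γ (-x) = -γ x := fun x => by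
    simp only [γ, htneg, hvneg, hembneg, hκ, smul_neg, neg_add]
  have hγ0 : γ 0 = 0 := by
    have h := hγneg 0
    rw [neg_zero] at h
    have h2 : (2 : ℝ) • γ 0 = 0 := by
      rw [two_smul]
      exact add_eq_zero_iff_eq_neg.2 h
    simpa using h2
  obtain ⟨x, hF, hG⟩ := exists_common_zero_of_odd_of_even
    (F := fun x i => ⟪g (i + 1), γ x⟫) (by fun_prop)
    (fun x => by ext i; simp [hγneg]) (G := fun x => max (‖γ x‖ - r) (‖v x‖ - ρ))
    (by fun_prop) (fun x => by simp only [hγneg, hvneg, norm_neg])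
    (by simp [hγ0, v, hr, hρ]) (R := ρ + 1) (fun x hx => by
      refine lt_max_of_lt_right ?_
      have h1 : ‖x‖ ≤ ‖v x‖ := (pi_norm_le_iff_of_nonneg (norm_nonneg _)).2 fun i => by
        rw [← hvi x i]
        simpa [hg.1] using norm_inner_le_norm (𝕜 := ℝ) (g i) (v x)
      linarith)
  have hle := max_le_iff.1 hG.le
  have ht1 : t x = 1 := by
    simp only [t]
    rw [max_eq_left (by linarith [hle.2]), div_self hρ.ne']
  have hsγ : synth g (emb x) + κ (emb x) = γ x := by rw [hsynth]
  refine ⟨emb x, hemb0 x, fun i hi hid => ?_, ?_, ?_⟩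
  · rw [hsγ]
    have h := congrFun hF ⟨i - 1, by omega⟩
    simpa [Nat.sub_add_cancel (Nat.one_le_iff_ne_zero.2 hi)] using h
  · rw [hsγ]
    linarith [hle.1]
  · rw [hsγ, hsynth, ht1, one_smul]
    rcases max_choice (‖γ x‖ - r) (‖v x‖ - ρ) with h | h
    · exact Or.inl (by linarith)
    · exact Or.inr (by linarith)

variable [CompleteSpace X]

lemma Orthonormal.hasSum_synth (hg : Orthonormal ℝ g) {a : ℕ → ℝ} (ha : a ∈ seqBall ρ) :
    HasSum (fun i => a i • g i) (synth g a) := by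
  have h : Summable fun i => ‖a i‖ ^ 2 :=
    summable_of_sum_range_le (fun _ => sq_nonneg _) (by simpa [seqBall] using ha)
  exact ((hg.orthogonalFamily.summable_iff_norm_sq_summable a).2 h).hasSum

lemma Orthonormal.norm_synth_le (hg : Orthonormal ℝ g) (hρ : 0 ≤ ρ) {a : ℕ → ℝ}
    (ha : a ∈ seqBall ρ) : ‖synth g a‖ ≤ ρ :=
  le_of_tendsto' (hg.hasSum_synth ha).tendsto_sum_nat.norm (hg.norm_sum_smul_le hρ ha)

lemma Orthonormal.hasSum_inner_synth (hg : Orthonormal ℝ g) {a : ℕ → ℝ} (ha : a ∈ seqBall ρ)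
    (u : X) : HasSum (fun i => a i * ⟪g i, u⟫) ⟪synth g a, u⟫ := by
  have h := (innerSL ℝ u).hasSum (hg.hasSum_synth ha)
  simpa [real_inner_comm u] using h

lemma Orthonormal.inner_synth (hg : Orthonormal ℝ g) {a : ℕ → ℝ} (ha : a ∈ seqBall ρ) (i : ℕ) :
    ⟪g i, synth g a⟫ = a i := by
  rw [real_inner_comm, ← (hg.hasSum_inner_synth ha (g i)).tsum_eq, tsum_eq_single i]
  · simp [hg.1 i]
  · intro j hj
    simp [hg.2 hj]

lemma Orthonormal.continuous_inner_synth (hg : Orthonormal ℝ g) (hρ : 0 ≤ ρ) (u : X) :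
    Continuous fun a : seqBall ρ => ⟪synth g a, u⟫ := by
  set b : ℕ → ℝ := fun i => ⟪g i, u⟫
  have hb : b ∈ seqBall ‖u‖ := hg.inner_mem_seqBall le_rfl
  have hbu : ∀ a : seqBall ρ, ⟪synth g a, u⟫ = ⟪synth g a, synth g b⟫ := fun a => by
    refine (hg.hasSum_inner_synth a.2 u).unique ?_
    simpa only [hg.inner_synth hb] using hg.hasSum_inner_synth a.2 (synth g b)
  have hunif : TendstoUniformly
      (fun n (a : seqBall ρ) => ⟪synth g a, ∑ i ∈ Finset.range n, b i • g i⟫)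
      (fun a => ⟪synth g a, u⟫) atTop := by
    have hlim := ((hg.hasSum_synth hb).tendsto_sum_nat.const_sub (synth g b)).norm.const_mul ρ
    rw [sub_self, norm_zero, mul_zero] at hlim
    refine Metric.tendstoUniformly_iff.2 fun ε hε => (hlim.eventually_lt_const hε).mono
      fun n hn a => lt_of_le_of_lt ?_ hn
    rw [Real.dist_eq, hbu, ← inner_sub_right]
    exact (abs_real_inner_le_norm _ _).trans
      (mul_le_mul_of_nonneg_right (hg.norm_synth_le hρ a.2) (norm_nonneg _))
  refine hunif.continuous (Frequently.of_forall fun n => ?_)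
  have : ∀ (a : seqBall ρ) i, ⟪synth g a, g i⟫ = a.1 i := fun a i => by
    rw [real_inner_comm, hg.inner_synth a.2]
  simp only [inner_sum, real_inner_smul_right, this]
  exact continuous_finsetSum _ fun i _ =>
    continuous_const.mul ((continuous_apply i).comp continuous_subtype_val)

lemma Orthonormal.continuous_inner_synth_apply (hg : Orthonormal ℝ g) (hρ : 0 ≤ ρ)
    (κ : C(seqBall ρ, X)) : Continuous fun a : seqBall ρ => ⟪synth g a, κ a⟫ := by
  refine continuous_iff_continuousAt.2 fun a => ?_
  have h1 : Tendsto (fun b => ρ * ‖κ b - κ a‖) (𝓝 a) (𝓝 0) := by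
    have h : Continuous fun b => ρ * ‖κ b - κ a‖ := by fun_prop
    simpa using h.tendsto a
  have h2 : Tendsto (fun b : seqBall ρ => ⟪synth g b, κ b - κ a⟫) (𝓝 a) (𝓝 0) :=
    squeeze_zero_norm (fun b => (norm_inner_le_norm _ _).trans
      (mul_le_mul_of_nonneg_right (hg.norm_synth_le hρ b.2) (norm_nonneg _))) h1
  have h3 := h2.add ((hg.continuous_inner_synth hρ (κ a)).tendsto a)
  simpa [ContinuousAt, inner_sub_right] using h3

/-- An intersection property of odd perturbations of the family `synth g`. -/
lemma Orthonormal.exists_link (hg : Orthonormal ℝ g) (hρ : 0 < ρ) {r : ℝ} (hr : 0 < r)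
    {κ : C(seqBall ρ, X)} (hκ : ∀ a, κ (seqBallNeg ρ a) = -κ a) :
    ∃ a : seqBall ρ, (∀ i, i ≠ 0 → ⟪g i, synth g a + κ a⟫ = 0) ∧ ‖synth g a + κ a‖ ≤ r ∧
      (‖synth g a + κ a‖ = r ∨ ‖synth g a‖ = ρ) := by
  choose b hb0 hbi hbr hb using hg.exists_link_of_finite hρ hr hκ
  obtain ⟨a, θ, hθ, hlim⟩ := CompactSpace.tendsto_subseq b
  have hweak : ∀ w, Tendsto (fun n => ⟪w, synth g (b (θ n)) + κ (b (θ n))⟫) atTop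
      (𝓝 ⟪w, synth g a + κ a⟫) := fun w => by
    have h : Continuous fun a : seqBall ρ => ⟪w, synth g a + κ a⟫ := by
      have h1 : Continuous fun a : seqBall ρ => ⟪w, κ a⟫ := by fun_prop
      have h2 := hg.continuous_inner_synth hρ.le w
      simp only [inner_add_right, real_inner_comm w] at h2 ⊢
      exact h2.add h1
    exact (h.tendsto a).comp hlim
  have horth : ∀ i, i ≠ 0 → ⟪g i, synth g a + κ a⟫ = 0 := fun i hi => by
    refine tendsto_nhds_unique (hweak (g i)) (tendsto_const_nhds.congr' ?_)
    filter_upwards [eventually_ge_atTop i] with n hn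
    exact (hbi _ i hi (hn.trans hθ.le_apply)).symm
  have hkey : ∀ (a : seqBall ρ) (u : X), (∀ i, i ≠ 0 → a.1 i = 0 ∨ ⟪g i, u⟫ = 0) →
      ⟪synth g a, u⟫ = ⟪g 0, synth g a⟫ * ⟪g 0, u⟫ := fun a u h => by
    rw [← (hg.hasSum_inner_synth a.2 u).tsum_eq, tsum_eq_single 0, hg.inner_synth a.2]
    intro i hi
    rcases h i hi with h | h <;> simp [h]
  have hcoord : Tendsto (fun n => ⟪g 0, synth g (b (θ n))⟫) atTop (𝓝 ⟪g 0, synth g a⟫) := by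
    have h := ((hg.continuous_inner_synth hρ.le (g 0)).tendsto a).comp hlim
    simpa only [real_inner_comm (g 0), Function.comp_def] using h
  have hinner : Tendsto (fun n => ⟪synth g (b (θ n)), synth g (b (θ n)) + κ (b (θ n))⟫) atTop
      (𝓝 ⟪synth g a, synth g a + κ a⟫) := by
    rw [hkey a _ fun i hi => Or.inr (horth i hi)]
    refine (hcoord.mul (hweak (g 0))).congr fun n => (hkey _ _ fun i hi => ?_).symm
    rcases le_or_gt i (θ n) with h | h
    · exact Or.inr (hbi _ i hi h)
    · exact Or.inl (hb0 _ i h)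
  have hpert : Tendsto (fun n => ⟪synth g (b (θ n)), κ (b (θ n))⟫) atTop
      (𝓝 ⟪synth g a, κ a⟫) :=
    ((hg.continuous_inner_synth_apply hρ.le κ).tendsto a).comp hlim
  have hκlim : Tendsto (fun n => ‖κ (b (θ n))‖) atTop (𝓝 ‖κ a‖) :=
    ((map_continuous κ).norm.tendsto a).comp hlim
  have hnorm : Tendsto (fun n => ‖synth g (b (θ n))‖) atTop (𝓝 ‖synth g a‖) := by
    have h := (hinner.sub hpert).sqrt
    simpa only [inner_add_right, add_sub_cancel_right, real_inner_self_eq_norm_sq,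
      Real.sqrt_sq (norm_nonneg _)] using h
  have hnormγ : Tendsto (fun n => ‖synth g (b (θ n)) + κ (b (θ n))‖) atTop
      (𝓝 ‖synth g a + κ a‖) := by
    have h := (((hnorm.pow 2).add (hpert.const_mul 2)).add (hκlim.pow 2)).sqrt
    simpa only [← norm_add_sq_real, Real.sqrt_sq (norm_nonneg _)] using h
  refine ⟨a, horth, le_of_tendsto' hnormγ fun n => hbr _, ?_⟩
  have hprod : Tendsto (fun n => (‖synth g (b (θ n)) + κ (b (θ n))‖ - r) *
      (‖synth g (b (θ n))‖ - ρ)) atTop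
      (𝓝 ((‖synth g a + κ a‖ - r) * (‖synth g a‖ - ρ))) :=
    (hnormγ.sub_const r).mul (hnorm.sub_const ρ)
  have h0 := tendsto_nhds_unique hprod (tendsto_const_nhds.congr (f₁ := fun _ => 0) fun n => by
    rcases hb (θ n) with h | h <;> simp [h])
  rcases mul_eq_zero.1 h0 with h | h
  · exact Or.inl (sub_eq_zero.1 h)
  · exact Or.inr (sub_eq_zero.1 h)

end SeqBall

lemma mem_orthogonal_topologicalClosure_span {X : Type*} [NormedAddCommGroup X]
    [InnerProductSpace ℝ X] {s : Set X} {u : X} (h : ∀ v ∈ s, ⟪v, u⟫ = 0) :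
    u ∈ (Submodule.span ℝ s).topologicalClosureᗮ := by
  rw [Submodule.orthogonal_closure, Submodule.mem_orthogonal]
  intro v hv
  induction hv using Submodule.span_induction with
  | mem v hv => exact h v hv
  | zero => exact inner_zero_left u
  | add v w _ _ hv hw => rw [inner_add_left, hv, hw, add_zero]
  | smul c v _ hv => rw [real_inner_smul_left, hv, mul_zero]

namespace FountainSetup

variable {X : Type*} [NormedAddCommGroup X] [InnerProductSpace ℝ X] [CompleteSpace X]
  (S : FountainSetup X)

lemma Q_of_mem_Y {u : X} (hu : u ∈ S.Y) : S.Q u = 0 := by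
  have h : S.Q u = u - S.P u := eq_sub_of_add_eq' (S.P_add_Q u)
  have h1 : S.Q u ∈ S.Y := h ▸ S.Y.sub_mem hu (S.P_mem u)
  exact inner_self_eq_zero.1 (S.Q_mem u _ h1)

lemma Q_of_mem_orthogonal {u : X} (hu : u ∈ S.Yᗮ) : S.Q u = u := by
  have h : S.P u = u - S.Q u := eq_sub_of_add_eq (S.P_add_Q u)
  have h1 : S.P u ∈ S.Yᗮ := h ▸ S.Yᗮ.sub_mem hu (S.Q_mem u)
  have h2 : S.P u = 0 := inner_self_eq_zero.1 (h1 _ (S.P_mem u))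
  have h3 := S.P_add_Q u
  rwa [h2, zero_add] at h3

lemma inner_P_e (u : X) (j : ℕ) : ⟪S.P u, S.e j⟫ = ⟪u, S.e j⟫ := by
  conv_rhs => rw [← S.P_add_Q u, inner_add_left, real_inner_comm _ (S.Q u),
    S.Q_mem u _ (S.e_mem j), add_zero]

lemma inner_e_f (i j : ℕ) : ⟪S.e i, S.f j⟫ = 0 := S.f_mem j _ (S.e_mem i)

lemma eq_zero_of_inner_eq_zero {u : X} (he : ∀ j, ⟪S.e j, u⟫ = 0) (hf : ∀ j, ⟪S.f j, u⟫ = 0) :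
    u = 0 := by
  have h1 : u ∈ S.Yᗮ := S.span_e ▸ mem_orthogonal_topologicalClosure_span (forall_mem_range.2 he)
  have h2 : u ∈ S.Yᗮᗮ := S.span_f ▸ mem_orthogonal_topologicalClosure_span (forall_mem_range.2 hf)
  exact inner_self_eq_zero.1 (h2 u h1)

lemma mem_Zk {k : ℕ} {u : X} (he : ∀ j, ⟪S.e j, u⟫ = 0) (hf : ∀ j < k, ⟪S.f j, u⟫ = 0) :
    u ∈ S.Zk k := by
  have : CompleteSpace (S.Zk k) := (Submodule.isClosed_topologicalClosure _).completeSpace_coe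
  have hmem := (S.Zk k).starProjection_apply_mem u
  have horth : ∀ v, (∀ j, k ≤ j → ⟪S.f j, v⟫ = 0) → ⟪v, (S.Zk k).starProjection u⟫ = 0 :=
    fun v hv => (real_inner_comm _ _).trans
      (mem_orthogonal_topologicalClosure_span (forall_mem_image.2 hv) _ hmem)
  have hdiff : u - (S.Zk k).starProjection u = 0 := by
    refine S.eq_zero_of_inner_eq_zero (fun j => ?_) fun j => ?_
    · rw [inner_sub_right, he, horth _ fun i _ =>
        (real_inner_comm _ _).trans (S.inner_e_f j i), sub_zero]
    · rcases lt_or_ge j k with h | h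
      · rw [inner_sub_right, hf j h, horth _ fun i hi => S.orth_f.2 (by omega), sub_zero]
      · exact (S.Zk k).sub_starProjection_mem_orthogonal u _
          (Submodule.le_topologicalClosure _ (Submodule.subset_span ⟨j, h, rfl⟩))
  exact sub_eq_zero.1 hdiff ▸ hmem

/-- The orthonormal basis `f k, f 0, …, f (k - 1), e 0, e 1, …` of `Y_k`. -/
def ykBasis (k : ℕ) (n : ℕ) : X :=
  if n = 0 then S.f k else if n ≤ k then S.f (n - 1) else S.e (n - (k + 1))

lemma orthonormal_ykBasis (k : ℕ) : Orthonormal ℝ (S.ykBasis k) := by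
  have h : Orthonormal ℝ (Sum.elim S.e S.f) := by
    refine ⟨?_, ?_⟩
    · rintro (i | i)
      exacts [S.orth_e.1 i, S.orth_f.1 i]
    · rintro (i | i) (j | j) hij
      · exact S.orth_e.2 (by simpa using hij)
      · exact S.inner_e_f i j
      · exact (real_inner_comm _ _).trans (S.inner_e_f j i)
      · exact S.orth_f.2 (by simpa using hij)
  let σ : ℕ → ℕ ⊕ ℕ := fun n =>
    if n = 0 then Sum.inr k else if n ≤ k then Sum.inr (n - 1) else Sum.inl (n - (k + 1))
  have hσ : Function.Injective σ := by
    intro m n hmn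
    simp only [σ] at hmn
    split_ifs at hmn <;> simp only [Sum.inr.injEq, Sum.inl.injEq] at hmn <;> omega
  convert h.comp σ hσ using 1
  ext n
  simp only [ykBasis, σ, Function.comp_apply]
  split_ifs <;> rfl

lemma ykBasis_zero (k : ℕ) : S.ykBasis k 0 = S.f k := by simp [ykBasis]

lemma ykBasis_succ {k j : ℕ} (hj : j < k) : S.ykBasis k (j + 1) = S.f j := by
  simp [ykBasis, Nat.succ_le_of_lt hj]

lemma ykBasis_add (k j : ℕ) : S.ykBasis k (k + 1 + j) = S.e j := by
  simp [ykBasis, show ¬ k + 1 + j ≤ k by omega]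

lemma Q_ykBasis_of_lt {k n : ℕ} (hn : k < n) : S.Q (S.ykBasis k n) = 0 := by
  obtain ⟨j, rfl⟩ := Nat.exists_eq_add_of_le (Nat.succ_le_of_lt hn)
  rw [Nat.succ_eq_add_one, ykBasis_add]
  exact S.Q_of_mem_Y (S.e_mem j)

lemma exists_ykBasis_of_le {k n : ℕ} (hn : n ≤ k) : ∃ j ≤ k, S.ykBasis k n = S.f j := by
  rcases n with _ | n
  · exact ⟨k, le_rfl, S.ykBasis_zero k⟩
  · exact ⟨n, by omega, S.ykBasis_succ (by omega)⟩

lemma Q_synth_ykBasis {k : ℕ} {ρ : ℝ} {a : ℕ → ℝ} (ha : a ∈ seqBall ρ) :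
    S.Q (synth (S.ykBasis k) a) = ∑ i ∈ Finset.range (k + 1), a i • S.ykBasis k i := by
  rw [← (S.Q.hasSum ((S.orthonormal_ykBasis k).hasSum_synth ha)).tsum_eq,
    tsum_eq_sum (s := Finset.range (k + 1))]
  · refine Finset.sum_congr rfl fun i hi => ?_
    obtain ⟨j, -, hj⟩ := S.exists_ykBasis_of_le (Nat.lt_succ_iff.1 (Finset.mem_range.1 hi))
    rw [map_smul, hj, S.Q_of_mem_orthogonal (S.f_mem j)]
  · intro i hi
    rw [map_smul, S.Q_ykBasis_of_lt (by simpa using hi), smul_zero]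

lemma synth_ykBasis_mem_Yk {k : ℕ} {ρ : ℝ} {a : ℕ → ℝ} (ha : a ∈ seqBall ρ) :
    synth (S.ykBasis k) a ∈ S.Yk k := by
  rw [← S.P_add_Q (synth _ a), S.Q_synth_ykBasis ha]
  refine Submodule.add_mem_sup (S.P_mem _) (Submodule.sum_mem _ fun i hi => ?_)
  obtain ⟨j, hjk, hj⟩ := S.exists_ykBasis_of_le (Nat.lt_succ_iff.1 (Finset.mem_range.1 hi))
  rw [hj]
  exact Submodule.smul_mem _ _ (Submodule.subset_span ⟨j, hjk, rfl⟩)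

lemma mem_Zk_of_inner_ykBasis {k : ℕ} {u : X} (h : ∀ i, i ≠ 0 → ⟪S.ykBasis k i, u⟫ = 0) :
    u ∈ S.Zk k :=
  S.mem_Zk (fun j => by rw [← S.ykBasis_add k j]; exact h _ (by omega))
    fun j hj => by rw [← S.ykBasis_succ hj]; exact h _ (by omega)

lemma continuous_tauNorm_synth {k : ℕ} {ρ : ℝ} (hρ : 0 ≤ ρ) (κ : C(seqBall ρ, X)) :
    Continuous fun a : seqBall ρ => S.tauNorm (synth (S.ykBasis k) a + κ a) := by
  have hg := S.orthonormal_ykBasis k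
  simp only [tauNorm, inner_P_e, map_add, inner_add_left]
  refine Continuous.max (continuous_tsum (u := fun j => (1 / 2 : ℝ) ^ (j + 1) * (ρ + ‖κ‖))
    (fun j => ?_) ?_ fun j a => ?_) ?_
  · have h1 : Continuous fun a : seqBall ρ => ⟪κ a, S.e j⟫ := by fun_prop
    exact continuous_const.mul ((hg.continuous_inner_synth hρ (S.e j)).add h1).abs
  · exact ((summable_nat_add_iff 1).2 summable_geometric_two).mul_right _
  · rw [norm_mul, Real.norm_of_nonneg (by positivity), norm_abs_eq_norm, ← inner_add_left]
    gcongr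
    calc ‖⟪synth (S.ykBasis k) a + κ a, S.e j⟫‖
        ≤ ‖synth (S.ykBasis k) a + κ a‖ * ‖S.e j‖ := norm_inner_le_norm _ _
      _ ≤ ρ + ‖κ‖ := by
          rw [S.orth_e.1 j, mul_one]
          exact (norm_add_le _ _).trans
            (add_le_add (hg.norm_synth_le hρ a.2) (κ.norm_coe_le_norm a))
  · have h : ∀ a : seqBall ρ, S.Q (synth (S.ykBasis k) a) =
        ∑ i ∈ Finset.range (k + 1), a.1 i • S.ykBasis k i := fun a => S.Q_synth_ykBasis a.2
    simp only [h]
    refine ((continuous_finsetSum _ fun i _ => ?_).add (by fun_prop)).norm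
    exact ((continuous_apply i).comp continuous_subtype_val).smul continuous_const

end FountainSetup

/-- **Lemma 2.1.**  Let `φ ∈ C¹(X, ℝ)` be even with `∇φ` weakly sequentially continuous.
If for some `k` and `ρ_k > r_k > 0` conditions `(A₁)`, `(A₂)'` hold and
`b_k = inf {φ(u) : u ∈ Z_k, ‖u‖ = r_k} > sup {φ(u) : ‖u‖_τ < δ}` for some `δ > 0`, then
there is a sequence `{u_n} ⊆ {φ ≤ d_k + 1}` with `inf_n ‖u_n‖_τ ≥ δ/2` and `φ'(u_n) → 0`
in `X'`. -/
theorem lemma_guodu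
    {X : Type*} [NormedAddCommGroup X] [InnerProductSpace ℝ X] [CompleteSpace X]
    (S : FountainSetup X) (φ : X → ℝ) (φ' : X → X →L[ℝ] ℝ)
    -- φ ∈ C¹(X, ℝ)
    (hderiv : ∀ u, HasFDerivAt φ (φ' u) u) (hC1 : Continuous φ')
    -- φ is even
    (heven : ∀ u, φ (-u) = φ u)
    -- ∇φ is weakly sequentially continuous
    (hwsc : WeaklySeqContDeriv φ')
    (k : ℕ) (ρkv rkv δ : ℝ) (hr : 0 < rkv) (hρr : rkv < ρkv) (hδ : 0 < δ)
    -- (A₁) : d_k = sup {φ(u) : u ∈ Y_k, ‖u‖ ≤ ρ_k} < ∞ ; `d` is an upper bound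
    (d : ℝ) (hd : ∀ u ∈ S.Yk k, ‖u‖ ≤ ρkv → φ u ≤ d)
    -- (A₂)' : a_k = sup {φ(u) : u ∈ Y_k, ‖u‖ = ρ_k} < inf {φ(u) : u ∈ Z_k, ‖u‖ ≤ r_k}
    (hA2' : ∃ a b : ℝ, a < b ∧ (∀ u ∈ S.Yk k, ‖u‖ = ρkv → φ u ≤ a) ∧
      (∀ u ∈ S.Zk k, ‖u‖ ≤ rkv → b ≤ φ u))
    -- (2.1) : b_k = inf {φ(u) : u ∈ Z_k, ‖u‖ = r_k} > sup {φ(u) : ‖u‖_τ < δ}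
    (hgap : ∃ c c' : ℝ, c < c' ∧ (∀ u : X, S.tauNorm u < δ → φ u ≤ c) ∧
      (∀ u ∈ S.Zk k, ‖u‖ = rkv → c' ≤ φ u)) :
    ∃ u : ℕ → X, (∀ n, φ (u n) ≤ d + 1) ∧ (∀ n, δ / 2 ≤ S.tauNorm (u n)) ∧
      Tendsto (fun n => ‖φ' (u n)‖) atTop (𝓝 0) := by
  have hρ : 0 < ρkv := hr.trans hρr
  have hg := S.orthonormal_ykBasis k
  obtain ⟨a₀, b₀, hab, hbd, hZ⟩ := hA2'
  obtain ⟨c, c', hcc', hτ, hsphere⟩ := hgap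
  have hYk : ∀ a : seqBall ρkv, synth (S.ykBasis k) a ∈ S.Yk k := fun a =>
    S.synth_ykBasis_mem_Yk a.2
  have hlink : ∀ κ : C(seqBall ρkv, X), (∀ a, κ (seqBallNeg ρkv a) = -κ a) →
      (∀ a : seqBall ρkv, φ (synth (S.ykBasis k) a + κ a) ≤ φ (synth (S.ykBasis k) a)) →
      ∃ a : seqBall ρkv, c' ≤ φ (synth (S.ykBasis k) a + κ a) := by
    intro κ hκ hle
    obtain ⟨a, horth, har, ha⟩ := hg.exists_link hρ hr hκ
    have hmem := S.mem_Zk_of_inner_ykBasis horth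
    rcases ha with ha | ha
    · exact ⟨a, hsphere _ hmem ha⟩
    · exact absurd ((hZ _ hmem har).trans ((hle a).trans (hbd _ (hYk a) ha))) hab.not_ge
  have hmain : ∀ n : ℕ, ∃ u, φ u ≤ d ∧ δ ≤ S.tauNorm u ∧ ‖φ' u‖ ≤ 1 / ((n : ℝ) + 1) := fun n =>
    exists_almost_critical_of_linking hderiv heven hwsc (ν := seqBallNeg ρkv)
      (ι := fun a => synth (S.ykBasis k) a)
      (fun a => Subtype.ext (neg_neg _)) (hg.continuous_inner_synth hρ.le)
      (fun a => synth_neg _ _) (fun a => hd _ (hYk a) (hg.norm_synth_le hρ.le a.2))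
      (S.continuous_tauNorm_synth hρ.le) hcc' hτ hlink (by positivity)
  choose u hud huδ hu using hmain
  exact ⟨u, fun n => (hud n).trans (by linarith), fun n => (half_le_self hδ.le).trans (huδ n),
    squeeze_zero (fun n => norm_nonneg _) hu tendsto_one_div_add_atTop_nhds_zero_nat⟩

end
end

section
/- Let X be a separable Hilbert space with X = Y ⊕ Z as in the setup and let φ ∈ C¹(X, ℝ) with ∇φ weakly sequentially continuous. Let R > 0 and B_R = {u ∈ X : ‖u‖ ≤ R}. If u ∈ B_R with ∇φ(u) ≠ 0 and ω(u) = 2∇φ(u)/‖∇φ(u)‖², then there exists a τ-open neighborhood V_u ⊆ X of u such that ⟨∇φ(v), ω(u)⟩ > 1 for every v ∈ V_u ∩ B_R. -/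
open Filter Topology Metric Set
open scoped RealInnerProductSpace

noncomputable section

/-- A bounded sequence whose inner products with every element of a set tend to `0` also has
inner products tending to `0` with every element of the closed linear span of that set. -/
theorem tendsto_inner_zero_of_mem_closure_span {X : Type*} [NormedAddCommGroup X]
    [InnerProductSpace ℝ X] {x : ℕ → X} {C : ℝ} (hC : ∀ n, ‖x n‖ ≤ C) {s : Set X}
    (hs : ∀ w ∈ s, Tendsto (fun n => ⟪x n, w⟫) atTop (𝓝 0)) {w : X}
    (hw : w ∈ (Submodule.span ℝ s).topologicalClosure) :
    Tendsto (fun n => ⟪x n, w⟫) atTop (𝓝 0) := by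
  have hspan : ∀ w ∈ Submodule.span ℝ s, Tendsto (fun n => ⟪x n, w⟫) atTop (𝓝 0) := by
    intro w hw
    induction hw using Submodule.span_induction with
    | mem w hw => exact hs w hw
    | zero => simp
    | add a b _ _ ha hb => simpa [inner_add_right] using ha.add hb
    | smul c a _ ha => simpa [real_inner_smul_right] using ha.const_mul c
  have hlip : ∀ n, LipschitzWith C.toNNReal (fun w => ⟪x n, w⟫) := fun n =>
    LipschitzWith.of_dist_le' fun a b => by
      rw [Real.dist_eq, ← inner_sub_right, dist_eq_norm]
      exact (abs_real_inner_le_norm _ _).trans (by gcongr; exact hC n)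
  have hclosed : IsClosed {w | Tendsto (fun n => ⟪x n, w⟫) atTop (𝓝 0)} :=
    (LipschitzWith.uniformEquicontinuous _ _ hlip).equicontinuous.isClosed_setOfPred_tendsto
      continuous_const
  exact closure_minimal hspan hclosed hw

namespace FountainSetup

variable {X : Type*} [NormedAddCommGroup X] [InnerProductSpace ℝ X] [CompleteSpace X]
variable (S : FountainSetup X)

theorem norm_Q_le_tauNorm (u : X) : ‖S.Q u‖ ≤ S.tauNorm u := le_max_right _ _

theorem tauNorm_nonneg (u : X) : 0 ≤ S.tauNorm u := (norm_nonneg _).trans (S.norm_Q_le_tauNorm u)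

theorem summable_tauNorm (u : X) :
    Summable fun j : ℕ => (1 / 2 : ℝ) ^ (j + 1) * |⟪S.P u, S.e j⟫| := by
  have hgeom : Summable fun j : ℕ => (1 / 2 : ℝ) ^ (j + 1) * ‖S.P u‖ :=
    ((summable_nat_add_iff 1).2 summable_geometric_two).mul_right _
  refine hgeom.of_nonneg_of_le (fun j => by positivity) fun j => ?_
  gcongr
  simpa [S.orth_e.1 j] using abs_real_inner_le_norm (S.P u) (S.e j)

theorem abs_inner_P_le_tauNorm (u : X) (j : ℕ) :
    |⟪S.P u, S.e j⟫| ≤ 2 ^ (j + 1) * S.tauNorm u := by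
  have h : (1 / 2 : ℝ) ^ (j + 1) * |⟪S.P u, S.e j⟫| ≤ S.tauNorm u :=
    ((S.summable_tauNorm u).le_tsum j fun i _ => by positivity).trans (le_max_left _ _)
  calc |⟪S.P u, S.e j⟫| = 2 ^ (j + 1) * ((1 / 2 : ℝ) ^ (j + 1) * |⟪S.P u, S.e j⟫|) := by
        rw [← mul_assoc, ← mul_pow]; norm_num
    _ ≤ _ := by gcongr

variable {S}

/-- On bounded sequences, τ-convergence implies weak convergence. -/
theorem TauTendsto.weakConv {x : ℕ → X} {u : X} (h : S.TauTendsto x u) {C : ℝ}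
    (hC : ∀ n, ‖x n‖ ≤ C) : WeakConv x u := by
  intro w
  have hP_bdd : ∀ n, ‖S.P (x n - u)‖ ≤ ‖S.P‖ * (C + ‖u‖) := fun n =>
    (S.P.le_opNorm _).trans (by gcongr; exact (norm_sub_le _ _).trans (by gcongr; exact hC n))
  have hP_e : ∀ v ∈ Set.range S.e, Tendsto (fun n => ⟪S.P (x n - u), v⟫) atTop (𝓝 0) := by
    rintro _ ⟨j, rfl⟩
    refine squeeze_zero_norm (fun n => S.abs_inner_P_le_tauNorm (x n - u) j) ?_
    simpa using Tendsto.const_mul ((2 : ℝ) ^ (j + 1)) h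
  have hP_Y : Tendsto (fun n => ⟪S.P (x n - u), S.P w⟫) atTop (𝓝 0) :=
    tendsto_inner_zero_of_mem_closure_span hP_bdd hP_e (by rw [S.span_e]; exact S.P_mem w)
  have hP : ∀ n, ⟪S.P (x n - u), w⟫ = ⟪S.P (x n - u), S.P w⟫ := fun n => by
    conv_lhs => rw [← S.P_add_Q w]
    rw [inner_add_right, Submodule.inner_right_of_mem_orthogonal (S.P_mem _) (S.Q_mem w), add_zero]
  have hQ : Tendsto (fun n => S.Q (x n - u)) atTop (𝓝 0) :=
    squeeze_zero_norm (fun n => S.norm_Q_le_tauNorm _) h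
  have hdiff : Tendsto (fun n => ⟪x n - u, w⟫) atTop (𝓝 0) := by
    have hsum := hP_Y.add (hQ.inner (tendsto_const_nhds (x := w)))
    rw [inner_zero_left, add_zero] at hsum
    refine hsum.congr fun n => ?_
    rw [← hP, ← inner_add_left, S.P_add_Q]
  simpa [inner_sub_left] using hdiff.add_const ⟪u, w⟫

end FountainSetup

/-- **The τ-neighborhood estimate (2.3) in the proof of Lemma 2.2.**  If `φ ∈ C¹(X, ℝ)` has a
weakly sequentially continuous gradient, `u ∈ B_R` with `∇φ(u) ≠ 0` and
`ω(u) = 2∇φ(u)/‖∇φ(u)‖²`, then there is a τ-open neighborhood `V_u` of `u` (a τ-ball) such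
that `⟨∇φ(v), ω(u)⟩ > 1` for every `v ∈ V_u ∩ B_R`. -/
theorem tau_neighborhood_of_nonvanishing_gradient
    {X : Type*} [NormedAddCommGroup X] [InnerProductSpace ℝ X] [CompleteSpace X]
    (S : FountainSetup X) (φ : X → ℝ) (φ' : X → X →L[ℝ] ℝ)
    -- φ ∈ C¹(X, ℝ)
    (hderiv : ∀ u, HasFDerivAt φ (φ' u) u) (hC1 : Continuous φ')
    -- ∇φ is weakly sequentially continuous
    (hwsc : WeaklySeqContDeriv φ')
    (R : ℝ) (hR : 0 < R)
    (u : X) (hu : ‖u‖ ≤ R)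
    -- ∇φ(u) ≠ 0
    (hne : φ' u ≠ 0)
    -- ω(u) = 2∇φ(u)/‖∇φ(u)‖², where ∇φ(u) is the Riesz representative of φ'(u)
    (ω : X) (hω : ω = (2 / ‖φ' u‖ ^ 2) • ((InnerProductSpace.toDual ℝ X).symm (φ' u))) :
    ∃ a : ℝ, 0 < a ∧ ∀ v : X, S.tauNorm (v - u) < a → ‖v‖ ≤ R → 1 < φ' v ω := by
  have hval : φ' u ω = 2 := by
    have hriesz : φ' u ((InnerProductSpace.toDual ℝ X).symm (φ' u)) = ‖φ' u‖ ^ 2 := by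
      rw [← InnerProductSpace.toDual_symm_apply, real_inner_self_eq_norm_sq,
        LinearIsometryEquiv.norm_map]
    have hnorm : ‖φ' u‖ ≠ 0 := norm_ne_zero_iff.2 hne
    rw [hω, map_smul, hriesz, smul_eq_mul]
    field_simp
  by_contra! hcon
  choose x hx_tau hx_norm hx_le using fun n : ℕ => hcon (1 / ((n : ℝ) + 1)) (by positivity)
  have htau : S.TauTendsto x u :=
    squeeze_zero (fun n => S.tauNorm_nonneg _) (fun n => (hx_tau n).le)
      tendsto_one_div_add_atTop_nhds_zero_nat
  have hle : φ' u ω ≤ 1 := le_of_tendsto' (hwsc x u (htau.weakConv hx_norm) ω) hx_le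
  linarith

end
end
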